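/- arXiv:0811.1978 — 3 statements merged into one kernel-verified Lean document; each statement's English description precedes it below -/
import Mathlib

section
/- Necessity of the depth condition: let m, n ≥ 1, ζ ∈ ℂ^m, M ≠ 0 a finite O_ζ-module with depth_{m_ζ} M = 0, and p : O_ζ^n → M an epimorphism. Then for every infinite-dimensional complex Banach space E there exists an O_ζ-homomorphism φ : O^E_ζ → M that does not factor through p. -/
open Filter Topology

/-- The value at `a` of a germ at `a` (well defined since every neighborhood contains `a`). -/
noncomputable def germValue {α β : Type*} [TopologicalSpace α] (a : α) :
    Filter.Germ (𝓝 a) β → β :=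
  fun g => g.liftOn (fun f => f a) (fun _ _ h => h.self_of_nhds)

variable (X : Type*) [NormedAddCommGroup X] [NormedSpace ℂ X]

/-- The local ring `O_ζ` of scalar holomorphic germs at `ζ`. -/
noncomputable def Oat (ζ : X) : Subring (Filter.Germ (𝓝 ζ) ℂ) where
  carrier := {g | ∃ f : X → ℂ, AnalyticAt ℂ f ζ ∧ g = ↑f}
  mul_mem' := by
    rintro a b ⟨f, hf, rfl⟩ ⟨k, hk, rfl⟩
    exact ⟨f * k, hf.mul hk, rfl⟩
  one_mem' := ⟨fun _ => 1, analyticAt_const, rfl⟩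
  add_mem' := by
    rintro a b ⟨f, hf, rfl⟩ ⟨k, hk, rfl⟩
    exact ⟨f + k, hf.add hk, rfl⟩
  zero_mem' := ⟨fun _ => 0, analyticAt_const, rfl⟩
  neg_mem' := by
    rintro a ⟨f, hf, rfl⟩
    exact ⟨-f, hf.neg, rfl⟩

noncomputable instance (ζ : X) (M : Type*) [AddCommGroup M]
    [Module (Filter.Germ (𝓝 ζ) ℂ) M] : Module (Oat X ζ) M :=
  Module.compHom M (Oat X ζ).subtype

variable (E : Type*) [NormedAddCommGroup E] [NormedSpace ℂ E]

/-- The `O_ζ`-module `O^E_ζ` of `E`-valued holomorphic germs at `ζ` (a "plain module"). -/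
noncomputable def OEat (ζ : X) : Submodule (Oat X ζ) (Filter.Germ (𝓝 ζ) E) where
  carrier := {g | ∃ f : X → E, AnalyticAt ℂ f ζ ∧ g = ↑f}
  add_mem' := by
    rintro a b ⟨f, hf, rfl⟩ ⟨k, hk, rfl⟩
    exact ⟨f + k, hf.add hk, rfl⟩
  zero_mem' := ⟨fun _ => 0, analyticAt_const, rfl⟩
  smul_mem' := by
    rintro ⟨c, a, ha, rfl⟩ x ⟨f, hf, rfl⟩
    exact ⟨fun z => a z • f z, ha.smul hf, rfl⟩

/-- The germ at `ζ` of a function analytic at `ζ`, as an element of `O^E_ζ`. -/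
noncomputable def germOf (ζ : X) (f : X → E) (hf : AnalyticAt ℂ f ζ) : OEat X E ζ :=
  ⟨(↑f : Filter.Germ (𝓝 ζ) E), f, hf, rfl⟩

/-- The constant germ at `ζ` with value `v`. -/
noncomputable def constGerm (ζ : X) (v : E) : OEat X E ζ :=
  germOf X E ζ (fun _ => v) analyticAt_const

/-- Evaluation at `ζ` as a ring homomorphism `O_ζ → ℂ`. -/
noncomputable def evalAt (ζ : X) : Oat X ζ →+* ℂ where
  toFun g := germValue ζ (g : Filter.Germ (𝓝 ζ) ℂ)
  map_one' := rfl
  map_mul' := by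
    rintro ⟨a, _⟩ ⟨b, _⟩
    induction a using Filter.Germ.inductionOn
    induction b using Filter.Germ.inductionOn
    rfl
  map_zero' := rfl
  map_add' := by
    rintro ⟨a, _⟩ ⟨b, _⟩
    induction a using Filter.Germ.inductionOn
    induction b using Filter.Germ.inductionOn
    rfl

/-- The maximal ideal `m_ζ ⊂ O_ζ` of germs vanishing at `ζ`. -/
noncomputable def mIdeal (ζ : X) : Ideal (Oat X ζ) := RingHom.ker (evalAt X ζ)

/-- Positivity of the `I`-depth of a module `M`: either `M = IM` (depth `+∞` by convention),
or there is a nonzerodivisor `r ∈ I` on `M` with `rM ≠ M`. -/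
def IsDepthPos (R : Type*) [CommRing R] (I : Ideal R) (M : Type*) [AddCommGroup M]
    [Module R M] : Prop :=
  (I • (⊤ : Submodule R M) = ⊤) ∨
    ∃ r ∈ I, (∀ x : M, r • x = 0 → x = 0) ∧ Ideal.span {r} • (⊤ : Submodule R M) ≠ ⊤

/-- The multilinear map on continuous functions induced pointwise by a continuous multilinear
map. -/
noncomputable def ContinuousMultilinearMap.pointwise {Y F K : Type*} [NormedAddCommGroup Y]
    [NormedSpace ℂ Y] [NormedAddCommGroup F] [NormedSpace ℂ F] [TopologicalSpace K]
    [CompactSpace K] {n : ℕ} (p : Y [×n]→L[ℂ] F) : C(K, Y) [×n]→L[ℂ] C(K, F) :=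
  MultilinearMap.mkContinuous
    { toFun := fun h => ⟨fun w => p (fun i => h i w), by fun_prop⟩
      map_update_add' := by
        intro _ h i a b
        ext w
        have key : ∀ c : C(K, Y), (fun j => Function.update h i c j w) =
            Function.update (fun j => h j w) i (c w) := by
          intro c
          ext1 j
          rcases eq_or_ne j i with rfl | hj <;> simp [*]
        simp [key]
      map_update_smul' := by
        intro _ h i c a
        ext w
        have key : ∀ c : C(K, Y), (fun j => Function.update h i c j w) =
            Function.update (fun j => h j w) i (c w) := by
          intro c
          ext1 j
          rcases eq_or_ne j i with rfl | hj <;> simp [*]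
        simp [key] }
    ‖p‖ (fun h => by
      rw [ContinuousMap.norm_le _ (by positivity)]
      intro w
      refine (p.le_opNorm _).trans ?_
      gcongr with i
      exact (h i).norm_coe_le_norm w)

theorem ContinuousMultilinearMap.norm_pointwise_le {Y F K : Type*} [NormedAddCommGroup Y]
    [NormedSpace ℂ Y] [NormedAddCommGroup F] [NormedSpace ℂ F] [TopologicalSpace K]
    [CompactSpace K] {n : ℕ} (p : Y [×n]→L[ℂ] F) :
    ‖(p.pointwise : C(K, Y) [×n]→L[ℂ] C(K, F))‖ ≤ ‖p‖ :=
  MultilinearMap.mkContinuous_norm_le _ (norm_nonneg _) _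

/-- Superposition by an analytic function is an analytic map between spaces of continuous
functions. -/
theorem exists_analyticOnNhd_superposition {Y F K : Type*} [NormedAddCommGroup Y]
    [NormedSpace ℂ Y] [NormedAddCommGroup F] [NormedSpace ℂ F] [CompleteSpace F]
    [TopologicalSpace K] [CompactSpace K] {f : Y → F} {p : FormalMultilinearSeries ℂ Y F}
    {r : ENNReal} (hf : HasFPowerSeriesOnBall f p 0 r) :
    ∃ N : C(K, Y) → C(K, F), AnalyticOnNhd ℂ N (Metric.eball 0 r) ∧
      ∀ h ∈ Metric.eball (0 : C(K, Y)) r, ∀ w, N h w = f (h w) := by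
  let P : FormalMultilinearSeries ℂ C(K, Y) C(K, F) := fun n => (p n).pointwise
  have hr : r ≤ P.radius := hf.r_le.trans <| FormalMultilinearSeries.radius_le_of_le
    fun n => ContinuousMultilinearMap.norm_pointwise_le (p n)
  have hP : HasFPowerSeriesOnBall P.sum P 0 P.radius :=
    P.hasFPowerSeriesOnBall (hf.r_pos.trans_le hr)
  refine ⟨P.sum, (hP.mono hf.r_pos hr).analyticOnNhd, fun h hh w => ?_⟩
  have h1 := (hP.mono hf.r_pos hr).hasSum hh
  have h2 := h1.mapL (ContinuousMap.evalCLM ℂ w)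
  have hw : h w ∈ Metric.eball (0 : Y) r := by
    rw [Metric.mem_eball, edist_zero_right] at hh ⊢
    refine lt_of_le_of_lt ?_ hh
    exact enorm_le_iff_norm_le.2 (h.norm_coe_le_norm w)
  have h3 := hf.hasSum hw
  simp only [zero_add] at h2 h3
  exact h2.unique h3

theorem AnalyticAt.exists_analyticAt_curry {X : Type*} [NormedAddCommGroup X] [NormedSpace ℂ X]
    {f : X × ℂ → ℂ} (hf : AnalyticAt ℂ f 0) :
    ∃ r > (0 : ℝ), AnalyticOnNhd ℂ f (Metric.ball 0 r) ∧ ∀ R < r,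
      ∃ F : X → C(Metric.closedBall (0 : ℂ) R, ℂ), AnalyticAt ℂ F 0 ∧
        ∀ x ∈ Metric.ball (0 : X) r, ∀ w, F x w = f (x, w) := by
  obtain ⟨p, r', hp⟩ := hf
  obtain ⟨r, hr, hrr⟩ := ENNReal.lt_iff_exists_nnreal_btwn.1 hp.r_pos
  have hr0 : 0 < r := by exact_mod_cast hr
  replace hp := hp.mono hr hrr.le
  refine ⟨r, hr0, by simpa using hp.analyticOnNhd, fun R hR => ?_⟩
  obtain ⟨N, hN, hNf⟩ := exists_analyticOnNhd_superposition (K := Metric.closedBall (0 : ℂ) R) hp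
  let ι : C(Metric.closedBall (0 : ℂ) R, X × ℂ) := ⟨fun w => (0, w), by fun_prop⟩
  let κ : X →L[ℂ] C(Metric.closedBall (0 : ℂ) R, X × ℂ) :=
    LinearMap.mkContinuous
      { toFun := fun x => ContinuousMap.const _ (x, 0)
        map_add' := by intro x y; ext w <;> simp
        map_smul' := by intro c x; ext w <;> simp } 1 (fun x => by
          rw [ContinuousMap.norm_le _ (by positivity)]
          intro w
          simp [Prod.norm_def])
  have hmem : ∀ x ∈ Metric.ball (0 : X) r, κ x + ι ∈ Metric.eball (0 : C(_, X × ℂ)) r := by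
    intro x hx
    rw [Metric.eball_coe, Metric.mem_ball, dist_zero_right,
      ContinuousMap.norm_lt_iff _ (by exact_mod_cast hr0)]
    intro w
    have h1 : ‖(w : ℂ)‖ < r := lt_of_le_of_lt (mem_closedBall_zero_iff.1 w.2) hR
    have h2 : ‖x‖ < r := by simpa using hx
    simpa [κ, ι, Prod.norm_def] using ⟨h2, h1⟩
  refine ⟨fun x => N (κ x + ι), ?_, fun x hx w => ?_⟩
  · refine (hN (κ 0 + ι) (hmem 0 (by simpa using hr0))).comp_of_eq ?_ rfl
    exact κ.analyticAt 0 |>.add analyticAt_const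
  · rw [hNf _ (hmem x hx)]
    simp [κ, ι]

open scoped BoundedContinuousFunction

/-- The scaled shift on bounded sequences, its left inverse, the first coordinate and the first
unit vector. -/
theorem exists_shift {ρ : ℝ} (hρ : 0 < ρ) :
    ∃ (S B : (ℕ →ᵇ ℂ) →L[ℂ] (ℕ →ᵇ ℂ))
      (c : (ℕ →ᵇ ℂ) →L[ℂ] ℂ) (e : (ℕ →ᵇ ℂ)),
      ‖S‖ ≤ ρ ∧ (∀ a, B (S a) = a) ∧ (∀ a, a = S (B a) + c a • e) ∧ (∀ a, c (S a) = 0) ∧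
        B e = 0 ∧ c e = 1 := by
  have hS : ∀ a : ℕ →ᵇ ℂ, ∀ n : ℕ, ‖(Nat.casesOn n 0 (fun k => a k) : ℂ)‖ ≤ ‖a‖ := by
    rintro a (_ | n)
    · simp
    · exact a.norm_coe_le_norm n
  let S₀ : (ℕ →ᵇ ℂ) →L[ℂ] (ℕ →ᵇ ℂ) := LinearMap.mkContinuous
    { toFun := fun a => BoundedContinuousFunction.ofNormedAddCommGroupDiscrete
        (fun n => Nat.casesOn n 0 (fun k => a k)) ‖a‖ (hS a)
      map_add' := by intro a b; ext (_ | n) <;> simp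
      map_smul' := by intro c b; ext (_ | n) <;> simp } 1 (fun a => by
        rw [one_mul]
        exact (BoundedContinuousFunction.norm_le (norm_nonneg a)).2 (hS a))
  have hS₀ : ∀ (a : ℕ →ᵇ ℂ) (n : ℕ), S₀ a n = Nat.casesOn n 0 (fun k => a k) := fun _ _ => rfl
  let B₀ : (ℕ →ᵇ ℂ) →L[ℂ] (ℕ →ᵇ ℂ) := LinearMap.mkContinuous
    { toFun := fun a => a.compContinuous ⟨Nat.succ, continuous_of_discreteTopology⟩
      map_add' := by intro a b; ext n; simp
      map_smul' := by intro c b; ext n; simp } 1 (fun a => by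
        rw [one_mul]
        exact (BoundedContinuousFunction.norm_le (norm_nonneg a)).2
          (fun n => a.norm_coe_le_norm _))
  have hB₀ : ∀ (a : ℕ →ᵇ ℂ) (n : ℕ), B₀ a n = a (n + 1) := fun _ _ => rfl
  let e : ℕ →ᵇ ℂ := BoundedContinuousFunction.ofNormedAddCommGroupDiscrete
    (fun n => if n = 0 then 1 else 0) 1 (fun n => by split_ifs <;> simp)
  have he : ∀ n : ℕ, e n = if n = 0 then 1 else 0 := fun _ => rfl
  have hρ' : (ρ : ℂ) ≠ 0 := by exact_mod_cast hρ.ne'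
  refine ⟨(ρ : ℂ) • S₀, (ρ : ℂ)⁻¹ • B₀, BoundedContinuousFunction.evalCLM ℂ 0, e, ?_, ?_, ?_, ?_,
    ?_, ?_⟩
  · rw [norm_smul, Complex.norm_real, Real.norm_of_nonneg hρ.le]
    exact mul_le_of_le_one_right hρ.le (LinearMap.mkContinuous_norm_le _ zero_le_one _)
  · intro a
    ext n
    simp only [map_smul, _root_.smul_apply, BoundedContinuousFunction.smul_apply, hB₀,
      hS₀, smul_eq_mul]
    field_simp
  · intro a
    ext (_ | n) <;> simp [hB₀, hS₀, he, hρ']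
  · intro a
    simp [hS₀]
  · ext n
    simp [hB₀, he]
  · simp [he]

/-- The `j`-th Taylor coefficient at `0`, given by an integral over the circle of radius `R`, as a
continuous functional. -/
theorem exists_coeff {R : ℝ} (hR : 0 < R) (j : ℕ) :
    ∃ τ : C(Metric.closedBall (0 : ℂ) R, ℂ) →L[ℂ] ℂ, ‖τ‖ ≤ R⁻¹ ^ j ∧
      ∀ a (g : ℂ → ℂ), (∀ z : Metric.closedBall (0 : ℂ) R, a z = g z) →
        τ a = (2 * Real.pi * Complex.I : ℂ)⁻¹ • ∮ z in C(0, R), z⁻¹ ^ j • z⁻¹ • g z := by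
  classical
  let ex : C(Metric.closedBall (0 : ℂ) R, ℂ) → ℂ → ℂ := fun a z =>
    if h : z ∈ Metric.closedBall (0 : ℂ) R then a ⟨z, h⟩ else 0
  have hext : ∀ a z (h : z ∈ Metric.sphere (0 : ℂ) R),
      ex a z = a ⟨z, Metric.sphere_subset_closedBall h⟩ := fun a z h =>
    dif_pos (Metric.sphere_subset_closedBall h)
  have hcont : ∀ a, ContinuousOn (fun z => z⁻¹ ^ j • z⁻¹ • ex a z) (Metric.sphere 0 R) := by
    intro a
    have h1 : ContinuousOn (ex a) (Metric.sphere 0 R) := by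
      rw [continuousOn_iff_continuous_domRestrict]
      have : (Metric.sphere (0 : ℂ) R).domRestrict (ex a) =
          fun z : Metric.sphere (0 : ℂ) R => a ⟨z, Metric.sphere_subset_closedBall z.2⟩ := by
        funext z
        exact hext a z z.2
      rw [this]
      fun_prop
    have h2 : ContinuousOn (fun z : ℂ => z⁻¹) (Metric.sphere 0 R) :=
      continuousOn_id.inv₀ fun z hz => Metric.ne_of_mem_sphere hz hR.ne'
    fun_prop
  have hcirc : ∀ a, CircleIntegrable (fun z => z⁻¹ ^ j • z⁻¹ • ex a z) 0 R := fun a =>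
    (hcont a).circleIntegrable hR.le
  let τ : C(Metric.closedBall (0 : ℂ) R, ℂ) →L[ℂ] ℂ := LinearMap.mkContinuous
    { toFun := fun a => (2 * Real.pi * Complex.I : ℂ)⁻¹ •
        ∮ z in C(0, R), z⁻¹ ^ j • z⁻¹ • ex a z
      map_add' := by
        intro a b
        rw [← smul_add, ← circleIntegral.integral_add (hcirc a) (hcirc b)]
        congr 1
        refine circleIntegral.integral_congr hR.le fun z hz => ?_
        simp [hext _ z hz, mul_add]
      map_smul' := by
        intro c a
        rw [RingHom.id_apply, smul_comm c, ← circleIntegral.integral_smul c]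
        congr 1
        refine circleIntegral.integral_congr hR.le fun z hz => ?_
        simp only [hext _ z hz, ContinuousMap.smul_apply, smul_eq_mul]
        ring }
    (R⁻¹ ^ j) (fun a => by
      have := circleIntegral.norm_two_pi_i_inv_smul_integral_le_of_norm_le_const hR.le
        (c := 0) (f := fun z => z⁻¹ ^ j • z⁻¹ • ex a z) (C := R⁻¹ ^ j * (R⁻¹ * ‖a‖)) (fun z hz => by
          have hz' : ‖z‖ = R := by simpa using hz
          simp only [norm_smul, norm_pow, norm_inv, hz', hext a z hz]
          gcongr
          exact a.norm_coe_le_norm _)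
      refine this.trans (le_of_eq ?_)
      field_simp)
  refine ⟨τ, LinearMap.mkContinuous_norm_le _ (by positivity) _, fun a g hg => ?_⟩
  change (2 * Real.pi * Complex.I : ℂ)⁻¹ • (∮ z in C(0, R), z⁻¹ ^ j • z⁻¹ • ex a z) = _
  congr 1
  refine circleIntegral.integral_congr hR.le fun z hz => ?_
  simp only [hext a z hz, hg]

/-- A holomorphic functional calculus for an element of norm less than `R` of a Banach algebra,
continuous for the uniform norm on the disc of radius `R`. -/
theorem exists_functionalCalculus {A : Type*} [NormedRing A] [NormedAlgebra ℂ A]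
    [CompleteSpace A] {R : ℝ} (hR : 0 < R) {s : A} (hs : ‖s‖ ≤ R / 2) :
    ∃ T : C(Metric.closedBall (0 : ℂ) R, ℂ) →L[ℂ] A,
      (∀ k a, (∀ w : Metric.closedBall (0 : ℂ) R, a w = (w : ℂ) ^ k) → T a = s ^ k) ∧
      ∀ a (g : ℂ → ℂ), DiffContOnCl ℂ g (Metric.ball 0 R) →
        (∀ z : Metric.closedBall (0 : ℂ) R, a z = g z) →
        ∃ γ : ℕ → ℂ, HasSum (fun j => γ j • s ^ j) (T a) ∧
          ∀ w : ℂ, ‖w‖ < R → HasSum (fun j => γ j * w ^ j) (g w) := by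
  choose τ hτ hτg using fun j => exists_coeff hR j
  let t : ℕ → C(Metric.closedBall (0 : ℂ) R, ℂ) →L[ℂ] A := fun j => (τ j).smulRight (s ^ j)
  have hbound : ∀ j, ‖t j‖ ≤ (1 / 2 : ℝ) ^ j * max 1 ‖(1 : A)‖ := by
    intro j
    have h1 : ‖s ^ j‖ ≤ (R / 2) ^ j * max 1 ‖(1 : A)‖ := by
      rcases j with _ | j
      · simp
      · refine (norm_pow_le' s j.succ_pos).trans ?_
        refine (pow_le_pow_left₀ (norm_nonneg _) hs _).trans ?_
        exact le_mul_of_one_le_right (by positivity) (le_max_left _ _)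
    calc ‖t j‖ = ‖τ j‖ * ‖s ^ j‖ := ContinuousLinearMap.norm_smulRight_apply _ _
      _ ≤ R⁻¹ ^ j * ((R / 2) ^ j * max 1 ‖(1 : A)‖) :=
          mul_le_mul (hτ j) h1 (norm_nonneg _) (by positivity)
      _ = _ := by
          rw [← mul_assoc, ← mul_pow]
          congr 2
          field_simp
  have hsum : Summable t :=
    Summable.of_norm_bounded
      ((summable_geometric_of_lt_one (by norm_num) (by norm_num)).mul_right _) hbound
  have happ : ∀ a, HasSum (fun j => τ j a • s ^ j) ((∑' j, t j) a) := fun a =>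
    hsum.hasSum.mapL (ContinuousLinearMap.apply ℂ A a)
  refine ⟨∑' j, t j, fun k a ha => ?_, fun a g hg hag => ⟨fun j => τ j a, happ a, fun w hw => ?_⟩⟩
  · refine (happ a).unique ?_
    have hcoef : ∀ j, τ j a = if j = k then 1 else 0 := by
      intro j
      rw [hτg j a (fun z => z ^ k) ha]
      have : (∮ z in C(0, R), z⁻¹ ^ j • z⁻¹ • z ^ k) =
          ∮ z in C(0, R), (z - 0) ^ ((k : ℤ) - j - 1) := by
        refine circleIntegral.integral_congr hR.le fun z hz => ?_
        have hz0 : z ≠ 0 := Metric.ne_of_mem_sphere hz hR.ne'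
        simp only [sub_zero, smul_eq_mul, zpow_sub₀ hz0, zpow_natCast, zpow_one, inv_pow]
        field_simp
      rw [this]
      split_ifs with hjk
      · subst hjk
        have h2 : (∮ z in C(0, R), (z - 0) ^ ((j : ℤ) - j - 1)) = 2 * Real.pi * Complex.I := by
          simpa [zpow_neg_one] using circleIntegral.integral_sub_center_inv (0 : ℂ) hR.ne'
        rw [h2, smul_eq_mul, inv_mul_cancel₀ Complex.two_pi_I_ne_zero]
      · rw [circleIntegral.integral_sub_zpow_of_ne (by omega), smul_zero]
    simp only [hcoef]
    convert hasSum_ite_eq k (s ^ k) using 2 with j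
    split_ifs with h <;> simp [h]
  · have hR' : 0 < R.toNNReal := Real.toNNReal_pos.2 hR
    have hg' : DiffContOnCl ℂ g (Metric.ball 0 R.toNNReal) := by
      rwa [Real.coe_toNNReal _ hR.le]
    have h2 := (hg'.hasFPowerSeriesOnBall hR').hasSum (y := w) (by
      rw [Metric.eball_coe, Real.coe_toNNReal _ hR.le]
      simpa using hw)
    rw [zero_add, Real.coe_toNNReal _ hR.le] at h2
    have hcoef : ∀ j, τ j a * w ^ j = cauchyPowerSeries g 0 R j fun _ => w := by
      intro j
      rw [hτg j a g hag, cauchyPowerSeries_apply]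
      have h3 : (∮ z in C(0, R), (w / (z - 0)) ^ j • (z - 0)⁻¹ • g z) =
          w ^ j • ∮ z in C(0, R), z⁻¹ ^ j • z⁻¹ • g z := by
        rw [← circleIntegral.integral_smul]
        refine circleIntegral.integral_congr hR.le fun z _ => ?_
        simp only [sub_zero, div_eq_mul_inv, mul_pow, smul_eq_mul]
        ring
      rw [h3, smul_eq_mul, smul_eq_mul, smul_eq_mul]
      ring
    simpa only [hcoef] using h2

theorem DiffContOnCl.of_analyticOnNhd_slice {X : Type*} [NormedAddCommGroup X] [NormedSpace ℂ X]
    {f : X × ℂ → ℂ} {r R : ℝ} (hf : AnalyticOnNhd ℂ f (Metric.ball 0 r)) (hR : R < r) {x : X}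
    (hx : x ∈ Metric.ball (0 : X) r) : DiffContOnCl ℂ (fun w => f (x, w)) (Metric.ball 0 R) := by
  refine DifferentiableOn.diffContOnCl fun w hw => ?_
  have hw' : ‖w‖ < r :=
    (mem_closedBall_zero_iff.1 (Metric.closure_ball_subset_closedBall hw)).trans_lt hR
  have hmem : (x, w) ∈ Metric.ball (0 : X × ℂ) r := by
    have : ‖x‖ < r := by simpa using hx
    simpa [Prod.norm_def] using ⟨this, hw'⟩
  exact ((hf _ hmem).differentiableAt.comp w (by fun_prop)).differentiableWithinAt

theorem AnalyticAt.clm_continuousMap {X A K : Type*} [NormedAddCommGroup X] [NormedSpace ℂ X]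
    [TopologicalSpace K] [CompactSpace K] [NormedRing A] [NormedAlgebra ℂ A]
    (T : C(K, ℂ) →L[ℂ] A) {F : X → C(K, ℂ)} {x : X} (hF : AnalyticAt ℂ F x) :
    AnalyticAt ℂ (fun x => T (F x)) x :=
  (@ContinuousLinearMap.analyticAt ℂ _ C(K, ℂ) _ _ A _ _ T _).comp hF

theorem AnalyticAt.exists_inverse_of_eq_one {X A : Type*} [NormedAddCommGroup X] [NormedSpace ℂ X]
    [NormedRing A] [NormedAlgebra ℂ A] [CompleteSpace A] {L : X → A} {x : X}
    (hL : AnalyticAt ℂ L x) (h1 : L x = 1) :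
    ∃ J : X → A, AnalyticAt ℂ J x ∧ ∀ᶠ y in 𝓝 x, J y * L y = 1 ∧ L y * J y = 1 := by
  have hinv : ∀ u : A, u = 1 → AnalyticAt ℂ Ring.inverse u := by
    rintro _ rfl
    exact analyticAt_inverse (𝕜 := ℂ) (1 : Aˣ)
  refine ⟨fun y => Ring.inverse (L y), (hinv _ h1).fun_comp hL, ?_⟩
  have : ∀ᶠ y in 𝓝 x, IsUnit (L y) :=
    hL.continuousAt.eventually (Units.isOpen.mem_nhds (by simp [h1]))
  filter_upwards [this] with y hy
  exact ⟨Ring.inverse_mul_cancel _ hy, Ring.mul_inverse_cancel _ hy⟩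

theorem AnalyticAt.exists_clm_inverse_of_eq_one {X V : Type*} [NormedAddCommGroup X]
    [NormedSpace ℂ X] [NormedAddCommGroup V] [NormedSpace ℂ V] [CompleteSpace V]
    {L : X → V →L[ℂ] V} {x : X} (hL : AnalyticAt ℂ L x) (h1 : ∀ v, L x v = v) :
    ∃ J : X → V →L[ℂ] V, AnalyticAt ℂ J x ∧
      ∀ᶠ y in 𝓝 x, ∀ v, J y (L y v) = v ∧ L y (J y v) = v := by
  obtain ⟨J, hJ, h⟩ := AnalyticAt.exists_inverse_of_eq_one (A := V →L[ℂ] V) hL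
    (ContinuousLinearMap.ext h1)
  exact ⟨J, hJ, h.mono fun y hy v => ⟨DFunLike.congr_fun hy.1 v, DFunLike.congr_fun hy.2 v⟩⟩

theorem AnalyticAt.clm_apply {X V W : Type*} [NormedAddCommGroup X] [NormedSpace ℂ X]
    [NormedAddCommGroup V] [NormedSpace ℂ V] [NormedAddCommGroup W] [NormedSpace ℂ W]
    {L : X → V →L[ℂ] W} {v : X → V} {x : X} (hL : AnalyticAt ℂ L x) (hv : AnalyticAt ℂ v x) :
    AnalyticAt ℂ (fun y => L y (v y)) x :=
  AnalyticAt.fun_comp (g := fun q : (V →L[ℂ] W) × V => q.1 q.2) (f := fun y => (L y, v y))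
    (ContinuousLinearMap.analyticAt_bilinear (ContinuousLinearMap.id ℂ (V →L[ℂ] W)) (L x, v x))
    (hL.prod hv)

/-- **Weierstrass division** by a function whose restriction to the last coordinate axis is
`w ^ k`. -/
theorem weierstrass_division {X : Type*} [NormedAddCommGroup X] [NormedSpace ℂ X]
    {f g : X × ℂ → ℂ} (hf : AnalyticAt ℂ f 0) (hg : AnalyticAt ℂ g 0) {k : ℕ}
    (hk : ∀ᶠ w in 𝓝 (0 : ℂ), f (0, w) = w ^ k) :
    ∃ (q : X × ℂ → ℂ) (r : ℕ → X → ℂ), AnalyticAt ℂ q 0 ∧ (∀ j, AnalyticAt ℂ (r j) 0) ∧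
      ∀ᶠ y in 𝓝 (0 : X × ℂ), g y = q y * f y + ∑ j ∈ Finset.range k, r j y.1 * y.2 ^ j := by
  obtain ⟨r₁, hr₁, hfr, hF⟩ := hf.exists_analyticAt_curry
  obtain ⟨r₂, hr₂, hgr, hG⟩ := hg.exists_analyticAt_curry
  obtain ⟨r₃, hr₃, hk'⟩ := Metric.eventually_nhds_iff_ball.1 hk
  obtain ⟨R, hR, hRlt⟩ := exists_between (lt_min hr₁ (lt_min hr₂ hr₃))
  obtain ⟨hR₁, hR₂₃⟩ := lt_min_iff.1 hRlt
  obtain ⟨hR₂, hR₃⟩ := lt_min_iff.1 hR₂₃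
  obtain ⟨F, hFan, hF⟩ := hF R hR₁
  obtain ⟨G, hGan, hG⟩ := hG R hR₂
  obtain ⟨S, B, c, e, hS, hBS, hdec, hcS, hBe, hce⟩ := exists_shift (half_pos hR)
  obtain ⟨T, hTpow, hT⟩ := exists_functionalCalculus (A := (ℕ →ᵇ ℂ) →L[ℂ] (ℕ →ᵇ ℂ)) hR hS
  let P : (ℕ →ᵇ ℂ) →L[ℂ] (ℕ →ᵇ ℂ) :=
    ∑ j ∈ Finset.range k, (c ∘L (B ^ j)).smulRight ((S ^ j) e)
  have hP : ∀ a, P a = ∑ j ∈ Finset.range k, c ((B ^ j) a) • (S ^ j) e := by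
    intro a
    simp [P]
  let L : X → (ℕ →ᵇ ℂ) →L[ℂ] (ℕ →ᵇ ℂ) := fun x => T (F x) * B ^ k + P
  have hTF : AnalyticAt ℂ (fun x => T (F x)) 0 := hFan.clm_continuousMap T
  have hLan : AnalyticAt ℂ L 0 :=
    AnalyticAt.fun_add (AnalyticAt.fun_comp (((ContinuousLinearMap.compL ℂ (ℕ →ᵇ ℂ) (ℕ →ᵇ ℂ)
      (ℕ →ᵇ ℂ)).flip (B ^ k)).analyticAt _) hTF) (analyticAt_const (v := P))
  have hL0 : L 0 = 1 := by
    have h1 : T (F 0) = S ^ k := by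
      refine hTpow k _ fun w => ?_
      rw [hF 0 (by simpa using hr₁), hk' w]
      exact mem_ball_zero_iff.2 ((mem_closedBall_zero_iff.1 w.2).trans_lt hR₃)
    have h2 : ∀ n a, a = (S ^ n) ((B ^ n) a) +
        ∑ j ∈ Finset.range n, c ((B ^ j) a) • (S ^ j) e := by
      intro n a
      induction n with
      | zero => simp
      | succ n ih =>
        have h3 : (S ^ n) ((B ^ n) a) =
            (S ^ (n + 1)) ((B ^ (n + 1)) a) + c ((B ^ n) a) • (S ^ n) e := by
          conv_lhs => rw [hdec ((B ^ n) a)]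
          rw [map_add, map_smul, pow_succ S, pow_succ' B]
          rfl
        conv_lhs => rw [ih, h3]
        rw [Finset.sum_range_succ]
        abel
    ext1 a
    change (T (F 0)) ((B ^ k) a) + P a = a
    rw [h1, hP, ← h2]
  obtain ⟨J, hJan, hJ⟩ := hLan.exists_clm_inverse_of_eq_one (DFunLike.congr_fun hL0)
  let b : X → (ℕ →ᵇ ℂ) := fun x => J x (T (G x) e)
  have hban : AnalyticAt ℂ b 0 :=
    AnalyticAt.clm_apply hJan ((hGan.clm_continuousMap T).clm_apply analyticAt_const)
  have hQan : AnalyticAt ℂ (fun w : ℂ => 1 - w • B) 0 :=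
    analyticAt_const.sub (analyticAt_id.smul analyticAt_const)
  obtain ⟨Q, hQan, hQ⟩ := hQan.exists_clm_inverse_of_eq_one (fun v => by simp)
  let ev : ℂ → (ℕ →ᵇ ℂ) →L[ℂ] ℂ := fun w => c ∘L Q w
  have hfst : AnalyticAt ℂ (fun y : X × ℂ => b y.1) 0 := AnalyticAt.fun_comp hban analyticAt_fst
  refine ⟨fun y => ev y.2 ((B ^ k) (b y.1)), fun j x => c ((B ^ j) (b x)), ?_, fun j => ?_, ?_⟩
  · exact (c.analyticAt _).fun_comp ((hQan.comp_of_eq analyticAt_snd rfl).clm_apply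
      (((B ^ k).analyticAt _).fun_comp hfst))
  · exact (c.analyticAt _).fun_comp (((B ^ j).analyticAt _).fun_comp hban)
  have e1 : ∀ᶠ x in 𝓝 (0 : X), (∀ v, J x (L x v) = v ∧ L x (J x v) = v) ∧
      x ∈ Metric.ball 0 r₁ ∧ x ∈ Metric.ball 0 r₂ :=
    hJ.and (Filter.Eventually.and (Metric.ball_mem_nhds _ hr₁) (Metric.ball_mem_nhds _ hr₂))
  have e2 : ∀ᶠ w in 𝓝 (0 : ℂ), (∀ v, Q w ((1 - w • B) v) = v ∧ (1 - w • B) (Q w v) = v) ∧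
      w ∈ Metric.ball 0 R :=
    hQ.and (Metric.ball_mem_nhds _ hR)
  filter_upwards [(continuous_fst.tendsto' (0 : X × ℂ) 0 rfl).eventually e1,
    (continuous_snd.tendsto' (0 : X × ℂ) 0 rfl).eventually e2]
  rintro ⟨x, w⟩ ⟨hLx, hx₁, hx₂⟩ ⟨hw, hwR⟩
  dsimp only at hLx hx₁ hx₂ hw hwR ⊢
  have hwR' : ‖w‖ < R := by simpa using hwR
  have hevS : ∀ v, ev w (S v) = w * ev w v := by
    intro v
    have h1 : S v = (1 - w • B) (S v) + w • v := by simp [hBS]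
    have h2 : Q w (S v) = S v + w • Q w v := by
      conv_lhs => rw [h1]
      rw [map_add, map_smul, (hw _).1]
    change c (Q w (S v)) = w * c (Q w v)
    rw [h2, map_add, hcS, map_smul, zero_add, smul_eq_mul]
  have heve : ev w e = 1 := by
    have h1 : (1 - w • B) e = e := by simp [hBe]
    have h2 : Q w e = e := by
      conv_lhs => rw [← h1]
      exact (hw _).1
    change c (Q w e) = 1
    rw [h2, hce]
  have hevpow : ∀ j v, ev w ((S ^ j) v) = w ^ j * ev w v := by
    intro j v
    induction j with
    | zero => simp
    | succ j ih => rw [pow_succ', mul_apply_eq_comp, hevS, ih]; ring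
  have hevT : ∀ a (h : ℂ → ℂ), DiffContOnCl ℂ h (Metric.ball 0 R) →
      (∀ z : Metric.closedBall (0 : ℂ) R, a z = h z) → ∀ v, ev w (T a v) = h w * ev w v := by
    intro a h hh hah v
    obtain ⟨γ, hγ, hγw⟩ := hT a h hh hah
    have h1 := (hγ.mapL (ContinuousLinearMap.apply ℂ (ℕ →ᵇ ℂ) v)).mapL (ev w)
    refine h1.unique ?_
    have h2 := (hγw w hwR').mul_right (ev w v)
    have h3 : ∀ j, γ j * w ^ j * ev w v = ev w ((γ j • S ^ j) v) := by
      intro j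
      rw [_root_.smul_apply, map_smul, hevpow, smul_eq_mul, mul_assoc]
    simp only [h3] at h2
    exact h2
  have hb : T (F x) ((B ^ k) (b x)) + P (b x) = T (G x) e := (hLx _).2
  have hb' := congrArg (ev w) hb
  rw [map_add, hevT _ _ (.of_analyticOnNhd_slice hfr hR₁ hx₁) (hF x hx₁ ·),
    hevT _ _ (.of_analyticOnNhd_slice hgr hR₂ hx₂) (hG x hx₂ ·), hP, map_sum, heve, mul_one] at hb'
  rw [← hb', mul_comm (f (x, w))]
  congr 1
  refine Finset.sum_congr rfl fun j _ => ?_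
  rw [map_smul, hevpow, heve, mul_one, smul_eq_mul]

/-- The germ of a scalar analytic function, as an element of the local ring. -/
noncomputable def analyticGerm {X : Type*} [NormedAddCommGroup X] [NormedSpace ℂ X] {ζ : X}
    (f : X → ℂ) (hf : AnalyticAt ℂ f ζ) : Oat X ζ :=
  ⟨(↑f : Germ (𝓝 ζ) ℂ), f, hf, rfl⟩

theorem exists_eq_analyticGerm {X : Type*} [NormedAddCommGroup X] [NormedSpace ℂ X] {ζ : X}
    (g : Oat X ζ) : ∃ f, ∃ hf : AnalyticAt ℂ f ζ, g = analyticGerm f hf := by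
  obtain ⟨_, f, hf, rfl⟩ := g
  exact ⟨f, hf, rfl⟩

theorem analyticGerm_eq_iff {X : Type*} [NormedAddCommGroup X] [NormedSpace ℂ X] {ζ : X}
    {f g : X → ℂ} {hf : AnalyticAt ℂ f ζ} {hg : AnalyticAt ℂ g ζ} :
    analyticGerm f hf = analyticGerm g hg ↔ f =ᶠ[𝓝 ζ] g := by
  rw [Subtype.ext_iff]
  exact Germ.coe_eq

theorem analyticGerm_eq_zero_iff {X : Type*} [NormedAddCommGroup X] [NormedSpace ℂ X] {ζ : X}
    {f : X → ℂ} {hf : AnalyticAt ℂ f ζ} : analyticGerm f hf = 0 ↔ ∀ᶠ y in 𝓝 ζ, f y = 0 :=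
  analyticGerm_eq_iff (g := fun _ => 0) (hg := analyticAt_const)

theorem analyticGerm_mul {X : Type*} [NormedAddCommGroup X] [NormedSpace ℂ X] {ζ : X}
    {f g : X → ℂ} (hf : AnalyticAt ℂ f ζ) (hg : AnalyticAt ℂ g ζ) :
    analyticGerm f hf * analyticGerm g hg = analyticGerm (fun y => f y * g y) (hf.fun_mul hg) :=
  rfl

theorem analyticGerm_add {X : Type*} [NormedAddCommGroup X] [NormedSpace ℂ X] {ζ : X}
    {f g : X → ℂ} (hf : AnalyticAt ℂ f ζ) (hg : AnalyticAt ℂ g ζ) :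
    analyticGerm f hf + analyticGerm g hg = analyticGerm (fun y => f y + g y) (hf.fun_add hg) :=
  rfl

theorem analyticGerm_pow {X : Type*} [NormedAddCommGroup X] [NormedSpace ℂ X] {ζ : X}
    {f : X → ℂ} (hf : AnalyticAt ℂ f ζ) (n : ℕ) :
    analyticGerm f hf ^ n = analyticGerm (fun y => f y ^ n) (hf.fun_pow n) :=
  rfl

theorem analyticGerm_sum {X ι : Type*} [NormedAddCommGroup X] [NormedSpace ℂ X] {ζ : X}
    (s : Finset ι) {f : ι → X → ℂ} (hf : ∀ i, AnalyticAt ℂ (f i) ζ) :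
    ∑ i ∈ s, analyticGerm (f i) (hf i) =
      analyticGerm (fun y => ∑ i ∈ s, f i y) (Finset.analyticAt_fun_sum s fun i _ => hf i) := by
  classical
  induction s using Finset.induction_on with
  | empty => rfl
  | insert a s ha ih =>
    rw [Finset.sum_insert ha, ih, analyticGerm_add, analyticGerm_eq_iff]
    exact .of_forall fun y => (Finset.sum_insert (f := fun i => f i y) ha).symm

theorem evalAt_analyticGerm {X : Type*} [NormedAddCommGroup X] [NormedSpace ℂ X] {ζ : X}
    {f : X → ℂ} (hf : AnalyticAt ℂ f ζ) : evalAt X ζ (analyticGerm f hf) = f ζ :=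
  rfl

theorem isUnit_analyticGerm {X : Type*} [NormedAddCommGroup X] [NormedSpace ℂ X] {ζ : X}
    {f : X → ℂ} (hf : AnalyticAt ℂ f ζ) (h : f ζ ≠ 0) : IsUnit (analyticGerm f hf) := by
  refine IsUnit.of_mul_eq_one (analyticGerm (fun y => (f y)⁻¹) (hf.fun_inv h)) ?_
  rw [analyticGerm_mul]
  refine (analyticGerm_eq_iff (hg := analyticAt_const)).2 ?_
  filter_upwards [hf.continuousAt.eventually_ne h] with y hy
  exact mul_inv_cancel₀ hy

/-- Constant germs. -/
noncomputable def constHom {X : Type*} [NormedAddCommGroup X] [NormedSpace ℂ X] (ζ : X) :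
    ℂ →+* Oat X ζ where
  toFun c := analyticGerm (fun _ => c) analyticAt_const
  map_one' := rfl
  map_mul' _ _ := rfl
  map_zero' := rfl
  map_add' _ _ := rfl

/-- Pullback of germs along an analytic map. -/
noncomputable def germPullback {X Y : Type*} [NormedAddCommGroup X] [NormedSpace ℂ X]
    [NormedAddCommGroup Y] [NormedSpace ℂ Y] {x : X} {y : Y} (φ : X → Y) (hφ : AnalyticAt ℂ φ x)
    (hy : φ x = y) : Oat Y y →+* Oat X x where
  toFun g := ⟨(g : Germ (𝓝 y) ℂ).compTendsto φ (hy ▸ hφ.continuousAt), by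
    obtain ⟨_, f, hf, rfl⟩ := g
    exact ⟨f ∘ φ, hf.comp_of_eq hφ hy, rfl⟩⟩
  map_one' := rfl
  map_zero' := rfl
  map_mul' := by
    rintro ⟨_, f, hf, rfl⟩ ⟨_, g, hg, rfl⟩
    rfl
  map_add' := by
    rintro ⟨_, f, hf, rfl⟩ ⟨_, g, hg, rfl⟩
    rfl

theorem germPullback_analyticGerm {X Y : Type*} [NormedAddCommGroup X] [NormedSpace ℂ X]
    [NormedAddCommGroup Y] [NormedSpace ℂ Y] {x : X} {y : Y} {φ : X → Y} (hφ : AnalyticAt ℂ φ x)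
    (hy : φ x = y) {f : Y → ℂ} (hf : AnalyticAt ℂ f y) :
    germPullback φ hφ hy (analyticGerm f hf) =
      analyticGerm (fun z => f (φ z)) (hf.comp_of_eq hφ hy) :=
  rfl

theorem germPullback_leftInverse {X Y : Type*} [NormedAddCommGroup X] [NormedSpace ℂ X]
    [NormedAddCommGroup Y] [NormedSpace ℂ Y] {x : X} {y : Y} {φ : X → Y} {χ : Y → X}
    (hφ : AnalyticAt ℂ φ x) (hy : φ x = y) (hχ : AnalyticAt ℂ χ y) (hx : χ y = x)
    (h : Function.LeftInverse χ φ) (g : Oat X x) :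
    germPullback φ hφ hy (germPullback χ hχ hx g) = g := by
  obtain ⟨f, hf, rfl⟩ := exists_eq_analyticGerm g
  rw [germPullback_analyticGerm, germPullback_analyticGerm, analyticGerm_eq_iff]
  exact .of_forall fun z => congrArg f (h z)

/-- An ideal of the local ring of `X × ℂ` containing a germ that is regular in the last variable
is finitely generated. -/
theorem Ideal.fg_of_regular_mem {X : Type*} [NormedAddCommGroup X] [NormedSpace ℂ X]
    [IsNoetherianRing (Oat X 0)] (I : Ideal (Oat (X × ℂ) 0)) {f : X × ℂ → ℂ}
    (hf : AnalyticAt ℂ f 0) {k : ℕ} (hk : ∀ᶠ w in 𝓝 (0 : ℂ), f (0, w) = w ^ k)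
    (hI : analyticGerm f hf ∈ I) : I.FG := by
  classical
  let π : Oat X 0 →+* Oat (X × ℂ) 0 := germPullback Prod.fst analyticAt_fst rfl
  let : Algebra (Oat X 0) (Oat (X × ℂ) 0) := π.toAlgebra
  let W : Oat (X × ℂ) 0 := analyticGerm Prod.snd analyticAt_snd
  let Φ : (Fin k → Oat X 0) →ₗ[Oat X 0] Oat (X × ℂ) 0 :=
    Fintype.linearCombination (Oat X 0) fun j => W ^ (j : ℕ)
  have hΦ : ∀ r, Φ r = ∑ j, π (r j) * W ^ (j : ℕ) := fun r => by
    simp [Φ, Fintype.linearCombination_apply, Algebra.smul_def, RingHom.algebraMap_toAlgebra]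
  obtain ⟨s, hs⟩ := IsNoetherian.noetherian ((I.restrictScalars (Oat X 0)).comap Φ)
  refine ⟨insert (analyticGerm f hf) (s.image Φ), le_antisymm ?_ ?_⟩
  · rw [Ideal.span_le]
    intro g hg
    rw [Finset.coe_insert, Set.mem_insert_iff, Finset.coe_image] at hg
    obtain rfl | ⟨r, hr, rfl⟩ := hg
    · exact hI
    · have : r ∈ (I.restrictScalars (Oat X 0)).comap Φ := hs ▸ Submodule.subset_span hr
      exact this
  · intro g hg
    obtain ⟨g, hga, rfl⟩ := exists_eq_analyticGerm g
    obtain ⟨q, r, hq, hr, hqr⟩ := weierstrass_division hf hga hk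
    have hdiv : analyticGerm g hga = analyticGerm q hq * analyticGerm f hf +
        Φ (fun j => analyticGerm (r j) (hr j)) := by
      simp only [hΦ, π, W, germPullback_analyticGerm, analyticGerm_pow, analyticGerm_mul]
      rw [analyticGerm_sum, analyticGerm_add, analyticGerm_eq_iff]
      filter_upwards [hqr] with y hy
      rw [hy, Finset.sum_range]
    have hfmem : analyticGerm q hq * analyticGerm f hf ∈
        Ideal.span (↑(insert (analyticGerm f hf) (s.image Φ)) : Set (Oat (X × ℂ) 0)) :=
      Ideal.mul_mem_left _ _ (Ideal.subset_span (by simp))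
    rw [hdiv] at hg ⊢
    refine add_mem hfmem ?_
    have h1 : (fun j : Fin k => analyticGerm (r j) (hr j)) ∈
        (I.restrictScalars (Oat X 0)).comap Φ :=
      (I.add_mem_iff_right (I.mul_mem_left _ hI)).1 hg
    rw [← hs] at h1
    have h2 := Submodule.mem_map_of_mem (f := Φ) h1
    rw [Submodule.map_span] at h2
    refine Submodule.span_le_restrictScalars (Oat X 0) (Oat (X × ℂ) 0) _
      (Submodule.span_mono ?_ h2)
    rw [Finset.coe_insert, Finset.coe_image]
    exact Set.subset_insert _ _

theorem AnalyticAt.exists_line_not_eventually_zero {Y : Type*} [NormedAddCommGroup Y]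
    [NormedSpace ℂ Y] {f : Y → ℂ} (hf : AnalyticAt ℂ f 0) (h : ¬ ∀ᶠ y in 𝓝 0, f y = 0) :
    ∃ v : Y, ¬ ∀ᶠ t in 𝓝 (0 : ℂ), f (t • v) = 0 := by
  by_contra! hall
  obtain ⟨r, hr, hfr⟩ := hf.exists_ball_analyticOnNhd
  refine h ?_
  filter_upwards [Metric.ball_mem_nhds (0 : Y) hr] with y hy
  let ℓ : ℂ →L[ℂ] Y := (ContinuousLinearMap.id ℂ ℂ).smulRight y
  have hconv : IsPreconnected (ℓ ⁻¹' Metric.ball 0 r) :=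
    ((convex_ball (0 : Y) r).linear_preimage
      (ℓ.toLinearMap.restrictScalars ℝ)).isPreconnected
  have han : AnalyticOnNhd ℂ (fun t => f (ℓ t)) (ℓ ⁻¹' Metric.ball 0 r) := fun t ht =>
    (hfr _ ht).comp (ℓ.analyticAt t)
  have h1 := han.eqOn_zero_of_preconnected_of_eventuallyEq_zero hconv (z₀ := 0)
    (by simpa using hr) (by simpa [ℓ, EventuallyEq] using hall y)
  have h2 := h1 (x := 1) (by simpa [ℓ] using hy)
  simpa [ℓ] using h2

theorem isNoetherianRing_Oat_prod {X : Type*} [NormedAddCommGroup X] [NormedSpace ℂ X]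
    [IsNoetherianRing (Oat X 0)] : IsNoetherianRing (Oat (X × ℂ) 0) := by
  rw [isNoetherianRing_iff_ideal_fg]
  intro I
  by_cases hI : I = ⊥
  · rw [hI]
    exact Submodule.fg_bot
  obtain ⟨g, hgI, hg0⟩ := Submodule.exists_mem_ne_zero_of_ne_bot hI
  obtain ⟨f, hf, rfl⟩ := exists_eq_analyticGerm g
  by_cases hf0 : f 0 = 0
  swap
  · rw [Ideal.eq_top_of_isUnit_mem _ hgI (isUnit_analyticGerm hf hf0)]
    exact ⟨{1}, by simp⟩
  obtain ⟨v, hv⟩ := hf.exists_line_not_eventually_zero fun h => hg0 (analyticGerm_eq_zero_iff.2 h)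
  have hv0 : v ≠ 0 := by
    rintro rfl
    exact hv (by simp [hf0])
  obtain ⟨A, hA⟩ := SeparatingDual.exists_continuousLinearEquiv_apply_eq (R := ℂ)
    (x := ((0, 1) : X × ℂ)) (y := v) (by simp) hv0
  have hAan : AnalyticAt ℂ A 0 := (A : X × ℂ →L[ℂ] X × ℂ).analyticAt 0
  have hAsan : AnalyticAt ℂ A.symm 0 := (A.symm : X × ℂ →L[ℂ] X × ℂ).analyticAt 0
  let α : Oat (X × ℂ) 0 →+* Oat (X × ℂ) 0 := germPullback A hAan (map_zero A)
  let β : Oat (X × ℂ) 0 →+* Oat (X × ℂ) 0 := germPullback A.symm hAsan (map_zero A.symm)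
  have hβα : ∀ g, β (α g) = g :=
    germPullback_leftInverse hAsan (map_zero A.symm) hAan (map_zero A) A.apply_symm_apply
  have hline : AnalyticAt ℂ (fun t : ℂ => f (A (0, t))) 0 :=
    AnalyticAt.comp_of_eq (g := f) (f := fun t : ℂ => A (0, t)) hf
      (hAan.comp_of_eq (analyticAt_const.prod analyticAt_id) rfl) (by simp)
  have hsmul : ∀ t : ℂ, A (0, t) = t • v := fun t => by
    rw [← hA, ← map_smul]
    simp
  obtain ⟨k, u, hu, hu0, hku⟩ := hline.exists_eventuallyEq_pow_smul_nonzero_iff.2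
    (by simpa only [hsmul] using hv)
  have hu2 : AnalyticAt ℂ (fun y : X × ℂ => (u y.2)⁻¹) 0 :=
    (hu.fun_inv hu0).comp_of_eq analyticAt_snd rfl
  have hfA : AnalyticAt ℂ (fun y => f (A y)) 0 := hf.comp_of_eq hAan (map_zero A)
  have hFG : (I.comap β).FG := by
    refine Ideal.fg_of_regular_mem (f := fun y => f (A y) * (u y.2)⁻¹) (k := k) _
      (hfA.fun_mul hu2) ?_ ?_
    · filter_upwards [hku, hu.continuousAt.eventually_ne hu0] with w hw hw0
      simp [hw, hw0]
    · rw [← analyticGerm_mul hfA hu2]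
      refine Ideal.mul_mem_right _ _ ?_
      have h1 : β (analyticGerm _ hfA) = analyticGerm f hf := hβα (analyticGerm f hf)
      rw [Ideal.mem_comap, h1]
      exact hgI
  rw [← Ideal.map_comap_of_surjective β (fun g => ⟨_, hβα g⟩) I]
  exact hFG.map β

theorem isNoetherianRing_Oat_zero (d : ℕ) : IsNoetherianRing (Oat (Fin d → ℂ) 0) := by
  induction d with
  | zero =>
    refine isNoetherianRing_of_surjective ℂ _ (constHom 0) fun g => ?_
    obtain ⟨f, hf, rfl⟩ := exists_eq_analyticGerm g
    exact ⟨f 0, (analyticGerm_eq_iff (hf := analyticAt_const)).2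
      (.of_forall fun y => congrArg f (Subsingleton.elim _ _))⟩
  | succ d ih =>
    have := isNoetherianRing_Oat_prod (X := Fin d → ℂ)
    let A : (Fin (d + 1) → ℂ) ≃L[ℂ] (Fin d → ℂ) × ℂ :=
      ContinuousLinearEquiv.ofFinrankEq (by simp)
    have hA : AnalyticAt ℂ A 0 := A.toContinuousLinearMap.analyticAt 0
    have hAs : AnalyticAt ℂ A.symm 0 := A.symm.toContinuousLinearMap.analyticAt 0
    exact isNoetherianRing_of_surjective _ _ (germPullback A hA (map_zero A)) fun g =>
      ⟨_, germPullback_leftInverse hA (map_zero A) hAs (map_zero A.symm) A.symm_apply_apply g⟩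

theorem isNoetherianRing_Oat {d : ℕ} (ζ : Fin d → ℂ) : IsNoetherianRing (Oat (Fin d → ℂ) ζ) := by
  have := isNoetherianRing_Oat_zero d
  have h1 : AnalyticAt ℂ (fun y => y - ζ) ζ := analyticAt_id.sub analyticAt_const
  have h2 : AnalyticAt ℂ (fun y => y + ζ) 0 := analyticAt_id.add analyticAt_const
  exact isNoetherianRing_of_surjective _ _ (germPullback _ h1 (sub_self ζ)) fun g =>
    ⟨_, germPullback_leftInverse h1 (sub_self ζ) h2 (zero_add ζ) (fun y => sub_add_cancel y ζ) g⟩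

theorem exists_ne_zero_smul_eq_zero_of_not_isDepthPos {R M : Type*} [CommRing R]
    [IsNoetherianRing R] {I : Ideal R} [AddCommGroup M] [Module R M] [Module.Finite R M]
    (h : ¬IsDepthPos R I M) : ∃ x : M, x ≠ 0 ∧ ∀ r ∈ I, r • x = 0 := by
  rw [IsDepthPos, not_or] at h
  obtain ⟨h1, h2⟩ := h
  push Not at h2
  have hsub : (I : Set R) ⊆ ⋃ P ∈ associatedPrimes R M, (P : Set R) := by
    rw [biUnion_associatedPrimes_eq_zero_divisors]
    intro r hr
    by_contra hcon
    have hreg : ∀ x : M, r • x = 0 → x = 0 := by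
      intro x hx
      by_contra hx0
      exact hcon ⟨x, hx0, hx⟩
    exact h1 (top_le_iff.1 ((h2 r hr hreg).ge.trans
      (Submodule.smul_mono ((Ideal.span_singleton_le_iff_mem I).2 hr) le_rfl)))
  obtain ⟨P, hP, hIP⟩ := (Ideal.subset_union_prime_finite (associatedPrimes.finite R M)
    (f := id) ⊤ ⊤ fun P hP _ _ => IsAssociatedPrime.isPrime hP).1 hsub
  rw [AssociatedPrimes.mem_iff, isAssociatedPrime_iff] at hP
  obtain ⟨hprime, x, hx⟩ := hP
  refine ⟨x, ?_, fun r hr => ?_⟩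
  · rintro rfl
    exact hprime.ne_top (by rw [hx]; simp)
  · have := hIP hr
    simpa [hx] using this

/-- An infinite-dimensional normed space carries a discontinuous linear functional. -/
theorem exists_not_continuous_linearMap {E : Type*} [NormedAddCommGroup E] [NormedSpace ℂ E]
    (hE : ¬FiniteDimensional ℂ E) : ∃ l : E →ₗ[ℂ] ℂ, ¬Continuous l := by
  let b := Module.Basis.ofVectorSpace ℂ E
  have hinf : Infinite (Module.Basis.ofVectorSpaceIndex ℂ E) := by
    by_contra h
    rw [not_infinite_iff_finite] at h
    exact hE (Module.Finite.of_basis b)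
  let s := Infinite.natEmbedding (Module.Basis.ofVectorSpaceIndex ℂ E)
  let l : E →ₗ[ℂ] ℂ := b.constr ℂ fun i => ((Function.invFun s i : ℕ) : ℂ) * ‖b i‖
  refine ⟨l, fun hl => ?_⟩
  obtain ⟨C, hC⟩ : ∃ C : ℝ, ∀ v, ‖l v‖ ≤ C * ‖v‖ := ⟨_, (⟨l, hl⟩ : E →L[ℂ] ℂ).le_opNorm⟩
  obtain ⟨N, hN⟩ := exists_nat_gt C
  have h1 := hC (b (s N))
  have h2 : l (b (s N)) = (N : ℂ) * ‖b (s N)‖ := by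
    simp only [l, Module.Basis.constr_basis]
    rw [Function.leftInverse_invFun s.injective]
  have h3 : 0 < ‖b (s N)‖ := norm_pos_iff.2 (b.ne_zero _)
  rw [h2, norm_mul, Complex.norm_natCast, Complex.norm_real, norm_norm] at h1
  exact absurd (le_of_mul_le_mul_right h1 h3) (not_le.2 hN)

theorem HasFPowerSeriesAt.diagonal_unique {X : Type*} [NormedAddCommGroup X] [NormedSpace ℂ X]
    {f g : X → ℂ} {ζ : X} {p q : FormalMultilinearSeries ℂ X ℂ} (hf : HasFPowerSeriesAt f p ζ)
    (hg : HasFPowerSeriesAt g q ζ) (hfg : f =ᶠ[𝓝 ζ] g) (n : ℕ) (e : X) :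
    (p n fun _ => e) = q n fun _ => e := by
  have h : HasFPowerSeriesAt (0 : X → ℂ) (p - q) ζ :=
    (hf.sub hg).congr (hfg.mono fun y hy => by simp [hy])
  simpa [sub_eq_zero] using h.apply_eq_zero n e

theorem HasFPowerSeriesAt.exists_linear_mul {X : Type*} [NormedAddCommGroup X] [NormedSpace ℂ X]
    {g : X → ℂ} {ζ : X} {p : FormalMultilinearSeries ℂ X ℂ} (hg : HasFPowerSeriesAt g p ζ)
    (h : X →L[ℂ] ℂ) :
    ∃ q : FormalMultilinearSeries ℂ X ℂ, HasFPowerSeriesAt (fun y => h (y - ζ) * g y) q ζ ∧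
      (∀ e, (q 0 fun _ => e) = 0) ∧ ∀ n e, (q (n + 1) fun _ => e) = h e * p n fun _ => e := by
  obtain ⟨r, hr⟩ := hg
  let L : ℂ →L[ℂ] X →L[ℂ] ℂ := (ContinuousLinearMap.id ℂ ℂ).smulRight h
  have h1 := (L.comp_hasFPowerSeriesOnBall hr).unshift (z := 0)
  refine ⟨_, ⟨r, h1.congr fun y _ => ?_⟩, fun e => ?_, fun n e => ?_⟩
  · simp [L, mul_comm]
  · simp [FormalMultilinearSeries.unshift]
  · simp only [FormalMultilinearSeries.unshift, Nat.succ_eq_add_one,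
      continuousMultilinearCurryRightEquiv_symm_apply']
    simp [L, mul_comm, Fin.init_def]

noncomputable instance {X : Type*} [NormedAddCommGroup X] [NormedSpace ℂ X] (ζ : X) :
    Algebra ℂ (Oat X ζ) :=
  (constHom ζ).toAlgebra

theorem exists_hasFPowerSeriesAt {X : Type*} [NormedAddCommGroup X] [NormedSpace ℂ X] {ζ : X}
    (g : Oat X ζ) : ∃ (p : FormalMultilinearSeries ℂ X ℂ) (f : X → ℂ) (hf : AnalyticAt ℂ f ζ),
      HasFPowerSeriesAt f p ζ ∧ g = analyticGerm f hf := by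
  obtain ⟨f, hf, rfl⟩ := exists_eq_analyticGerm g
  exact ⟨hf.choose, f, hf, hf.choose_spec, rfl⟩

/-- The value at `(e, …, e)` of the homogeneous term of degree `n` of the Taylor expansion of a
germ. -/
noncomputable def taylorCoeff {X : Type*} [NormedAddCommGroup X] [NormedSpace ℂ X] (ζ : X) (e : X)
    (n : ℕ) : Oat X ζ →ₗ[ℂ] ℂ :=
  have key : ∀ (g : Oat X ζ) (p : FormalMultilinearSeries ℂ X ℂ) (f : X → ℂ)
      (hf : AnalyticAt ℂ f ζ), HasFPowerSeriesAt f p ζ → g = analyticGerm f hf →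
      ((exists_hasFPowerSeriesAt g).choose n fun _ => e) = p n fun _ => e := by
    intro g p f hf hp hg
    obtain ⟨f', hf', hp', hg'⟩ := (exists_hasFPowerSeriesAt g).choose_spec
    exact hp'.diagonal_unique hp (analyticGerm_eq_iff.1 (hg'.symm.trans hg)) n e
  { toFun := fun g => (exists_hasFPowerSeriesAt g).choose n fun _ => e
    map_add' := by
      intro g₁ g₂
      obtain ⟨p₁, f₁, hf₁, hp₁, h₁⟩ := exists_hasFPowerSeriesAt g₁
      obtain ⟨p₂, f₂, hf₂, hp₂, h₂⟩ := exists_hasFPowerSeriesAt g₂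
      rw [key g₁ p₁ f₁ hf₁ hp₁ h₁, key g₂ p₂ f₂ hf₂ hp₂ h₂,
        key (g₁ + g₂) (p₁ + p₂) _ (hf₁.fun_add hf₂) (hp₁.add hp₂)
          (by rw [h₁, h₂, analyticGerm_add])]
      simp
    map_smul' := by
      intro c g
      obtain ⟨p, f, hf, hp, h⟩ := exists_hasFPowerSeriesAt g
      rw [key g p f hf hp h, key (c • g) (c • p) (c • f) hf.const_smul hp.const_smul
        (by rw [h, Algebra.smul_def]; rfl)]
      simp }

theorem taylorCoeff_analyticGerm {X : Type*} [NormedAddCommGroup X] [NormedSpace ℂ X] {ζ : X}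
    {f : X → ℂ} (hf : AnalyticAt ℂ f ζ) {p : FormalMultilinearSeries ℂ X ℂ}
    (hp : HasFPowerSeriesAt f p ζ) (e : X) (n : ℕ) :
    taylorCoeff ζ e n (analyticGerm f hf) = p n fun _ => e := by
  obtain ⟨f', hf', hp', hg'⟩ := (exists_hasFPowerSeriesAt (analyticGerm f hf)).choose_spec
  exact hp'.diagonal_unique hp (analyticGerm_eq_iff.1 hg'.symm) n e

/-- The germ of a linear form centered at `ζ`. -/
noncomputable def linearGerm {X : Type*} [NormedAddCommGroup X] [NormedSpace ℂ X] (ζ : X)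
    (h : X →L[ℂ] ℂ) : Oat X ζ :=
  analyticGerm (fun y => h (y - ζ))
    ((h.analyticAt _).comp_of_eq (analyticAt_id.sub analyticAt_const) rfl)

theorem taylorCoeff_zero_linearGerm_mul {X : Type*} [NormedAddCommGroup X] [NormedSpace ℂ X]
    {ζ : X} (h : X →L[ℂ] ℂ) (e : X) (g : Oat X ζ) :
    taylorCoeff ζ e 0 (linearGerm ζ h * g) = 0 := by
  obtain ⟨p, f, hf, hp, rfl⟩ := exists_hasFPowerSeriesAt g
  obtain ⟨q, hq, hq0, -⟩ := hp.exists_linear_mul h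
  exact (taylorCoeff_analyticGerm hq.analyticAt hq e 0).trans (hq0 e)

theorem taylorCoeff_succ_linearGerm_mul {X : Type*} [NormedAddCommGroup X] [NormedSpace ℂ X]
    {ζ : X} (h : X →L[ℂ] ℂ) (e : X) (n : ℕ) (g : Oat X ζ) :
    taylorCoeff ζ e (n + 1) (linearGerm ζ h * g) = h e * taylorCoeff ζ e n g := by
  obtain ⟨p, f, hf, hp, rfl⟩ := exists_hasFPowerSeriesAt g
  obtain ⟨q, hq, -, hqs⟩ := hp.exists_linear_mul h
  rw [taylorCoeff_analyticGerm hf hp, ← hqs]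
  exact taylorCoeff_analyticGerm hq.analyticAt hq e (n + 1)

theorem exists_norm_taylorCoeff_le {X : Type*} [NormedAddCommGroup X] [NormedSpace ℂ X]
    {ζ : X} (e : X) (g : Oat X ζ) :
    ∃ C K : ℝ, ∀ n, ‖taylorCoeff ζ e n g‖ ≤ C * K ^ n := by
  obtain ⟨p, f, hf, hp, rfl⟩ := exists_hasFPowerSeriesAt g
  obtain ⟨C, r, hC, hr, h⟩ := p.le_mul_pow_of_radius_pos hp.radius_pos
  refine ⟨C, r * ‖e‖, fun n => ?_⟩
  rw [taylorCoeff_analyticGerm hf hp, mul_pow, ← mul_assoc]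
  refine ((p n).le_opNorm _).trans ?_
  rw [Finset.prod_const, Finset.card_univ, Fintype.card_fin]
  gcongr
  exact h n

theorem exists_analyticAt_series {E : Type*} [NormedAddCommGroup E] [NormedSpace ℂ E]
    [CompleteSpace E] {v : ℕ → E} (hv : ∀ n, ‖v n‖ ≤ 1) :
    ∃ G : ℕ → ℂ → E, (∀ N, AnalyticAt ℂ (G N) 0) ∧
      ∀ N, ∀ᶠ t in 𝓝 (0 : ℂ), G N t = v N + t • G (N + 1) t := by
  let p : ℕ → FormalMultilinearSeries ℂ ℂ E := fun N n =>
    ContinuousMultilinearMap.mkPiRing ℂ (Fin n) (v (N + n))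
  have hrad : ∀ N, 1 ≤ (p N).radius := by
    intro N
    refine (p N).le_radius_of_bound (r := 1) 1 fun n => ?_
    simpa [p] using hv (N + n)
  have hp : ∀ N, HasFPowerSeriesOnBall (p N).sum (p N) 0 1 := fun N =>
    ((p N).hasFPowerSeriesOnBall (zero_lt_one.trans_le (hrad N))).mono zero_lt_one (hrad N)
  have hsum : ∀ N, ∀ t ∈ Metric.eball (0 : ℂ) 1,
      HasSum (fun n => t ^ n • v (N + n)) ((p N).sum t) := by
    intro N t ht
    simpa [p] using (hp N).hasSum ht
  refine ⟨fun N => (p N).sum, fun N => (hp N).analyticAt, fun N => ?_⟩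
  filter_upwards [Metric.eball_mem_nhds (0 : ℂ) zero_lt_one] with t ht
  have h1 : HasSum (fun n => t ^ (n + 1) • v (N + (n + 1))) (t • (p (N + 1)).sum t) := by
    have h2 := (hsum (N + 1) t ht).const_smul t
    simpa only [smul_smul, ← pow_succ', add_right_comm N 1, add_assoc] using h2
  have h3 := (hasSum_nat_add_iff' (f := fun n => t ^ n • v (N + n)) 1).2 (hsum N t ht)
  rw [h1.unique h3]
  simp

/-- The sequence whose terms are chosen one after the other by a rule that sees all the preceding
terms. -/
def seqOfRule {α : Type*} (rule : ∀ n : ℕ, (Fin n → α) → α) : ℕ → α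
  | n => rule n fun i => seqOfRule rule i
decreasing_by exact i.2

theorem LinearMap.exists_le_norm_of_not_continuous {E : Type*} [NormedAddCommGroup E]
    [NormedSpace ℂ E] {D : E →ₗ[ℂ] ℂ} (hD : ¬Continuous D) (B : ℝ) :
    ∃ v : E, ‖v‖ ≤ 1 ∧ B ≤ ‖D v‖ := by
  by_contra! h
  refine hD (D.mkContinuous (B / 1) ?_).continuous
  exact D.bound_of_ball_bound' one_pos B fun z hz => (h z (by simpa using hz)).le

theorem not_forall_factorial_le_mul_pow (s : ℕ) (C K : ℝ) :
    ¬∀ j : ℕ, ((j + s).factorial : ℝ) ≤ C * K ^ (j + s) := by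
  intro h
  have h1 := ((FloorSemiring.tendsto_pow_div_factorial_atTop K).const_mul C).comp
    (tendsto_add_atTop_nat s)
  rw [mul_zero] at h1
  obtain ⟨j, hj⟩ := (h1.eventually_lt_const one_pos).exists
  have h2 : (0 : ℝ) < (j + s).factorial := by positivity
  simp only [Function.comp_apply, ← mul_div_assoc, div_lt_one h2] at hj
  exact (h j).not_gt hj

section
variable {X E : Type*} [NormedAddCommGroup X] [NormedSpace ℂ X] [NormedAddCommGroup E]
  [NormedSpace ℂ E] {ζ : X}

/-- The restriction of a homomorphism of plain modules to constant germs. -/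
noncomputable def constImage (ψ : OEat X E ζ →ₗ[Oat X ζ] Oat X ζ) : E →ₗ[ℂ] Oat X ζ where
  toFun v := ψ (constGerm X E ζ v)
  map_add' v w := map_add ψ (constGerm X E ζ v) (constGerm X E ζ w)
  map_smul' c v := map_smul ψ (constHom ζ c) (constGerm X E ζ v)

/-- The Taylor coefficients of the images of constant germs under a homomorphism of plain
modules. -/
noncomputable def constCoeff (ψ : OEat X E ζ →ₗ[Oat X ζ] Oat X ζ) (e : X) (n : ℕ) : E →ₗ[ℂ] ℂ :=
  taylorCoeff ζ e n ∘ₗ constImage ψ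

theorem exists_germ_series [CompleteSpace E] (h : X →L[ℂ] ℂ) {v : ℕ → E} (hv : ∀ n, ‖v n‖ ≤ 1) :
    ∃ F : ℕ → OEat X E ζ, ∀ N, F N = constGerm X E ζ (v N) + linearGerm ζ h • F (N + 1) := by
  obtain ⟨G, hG, hrec⟩ := exists_analyticAt_series hv
  have hlin : AnalyticAt ℂ (fun y => h (y - ζ)) ζ :=
    (h.analyticAt _).comp_of_eq (analyticAt_id.sub analyticAt_const) rfl
  have h0 : h (ζ - ζ) = 0 := by simp
  refine ⟨fun N => germOf X E ζ (fun y => G N (h (y - ζ))) ((hG N).comp_of_eq hlin h0),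
    fun N => Subtype.ext (Germ.coe_eq.2 ?_)⟩
  exact (hlin.continuousAt.tendsto.eventually (h0.symm ▸ hrec N) :)

theorem taylorCoeff_map_series (ψ : OEat X E ζ →ₗ[Oat X ζ] Oat X ζ) {h : X →L[ℂ] ℂ} {e : X}
    (he : h e = 1) {v : ℕ → E} {F : ℕ → OEat X E ζ}
    (hF : ∀ N, F N = constGerm X E ζ (v N) + linearGerm ζ h • F (N + 1)) (n : ℕ) :
    ∀ N, taylorCoeff ζ e n (ψ (F N)) =
      ∑ j ∈ Finset.range (n + 1), constCoeff ψ e (n - j) (v (N + j)) := by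
  induction n with
  | zero =>
    intro N
    rw [hF, map_add, map_smul, smul_eq_mul, map_add, taylorCoeff_zero_linearGerm_mul]
    simp only [zero_add, Finset.range_one, Finset.sum_singleton, add_zero]
    rfl
  | succ n ih =>
    intro N
    rw [hF, map_add, map_smul, smul_eq_mul, map_add, taylorCoeff_succ_linearGerm_mul, he, one_mul,
      ih, Finset.sum_range_succ' _ (n + 1), add_comm]
    congr 1
    refine Finset.sum_congr rfl fun j _ => ?_
    rw [Nat.add_sub_add_right, add_assoc, add_comm 1]

theorem continuous_constCoeff [CompleteSpace E] (ψ : OEat X E ζ →ₗ[Oat X ζ] Oat X ζ) {e : X}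
    (he : e ≠ 0) (s : ℕ) : Continuous (constCoeff ψ e s) := by
  induction s using Nat.strong_induction_on with
  | _ s ih =>
  by_contra hs
  choose pick hpick hpick' using LinearMap.exists_le_norm_of_not_continuous hs
  have hbound : ∀ k, ∃ c : ℝ, k < s → ∀ v : E, ‖v‖ ≤ 1 → ‖constCoeff ψ e k v‖ ≤ c := by
    intro k
    by_cases hk : k < s
    · let D : E →L[ℂ] ℂ := ⟨constCoeff ψ e k, ih k hk⟩
      exact ⟨‖D‖, fun _ v hv => D.unit_le_opNorm v hv⟩
    · exact ⟨0, fun h => absurd h hk⟩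
  choose c hc using hbound
  let v : ℕ → E := seqOfRule fun j w => pick ((j + s).factorial +
    ‖∑ i : Fin j, constCoeff ψ e (j + s - i) (w i)‖ + ∑ x ∈ Finset.range s, c (s - (x + 1)))
  have hv : ∀ j, v j = pick ((j + s).factorial +
      ‖∑ i : Fin j, constCoeff ψ e (j + s - i) (v i)‖ + ∑ x ∈ Finset.range s, c (s - (x + 1))) :=
    fun j => by simp only [v]; rw [seqOfRule]
  have hv1 : ∀ j, ‖v j‖ ≤ 1 := fun j => by rw [hv]; exact hpick _
  obtain ⟨h, hh⟩ := SeparatingDual.exists_eq_one (R := ℂ) he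
  obtain ⟨F, hF⟩ := exists_germ_series (ζ := ζ) h hv1
  obtain ⟨C, K, hCK⟩ := exists_norm_taylorCoeff_le e (ψ (F 0))
  refine not_forall_factorial_le_mul_pow s C K fun j => le_trans ?_ (hCK (j + s))
  have h1 : ((j + s).factorial : ℝ) + ‖∑ i : Fin j, constCoeff ψ e (j + s - i) (v i)‖ +
      ∑ x ∈ Finset.range s, c (s - (x + 1)) ≤ ‖constCoeff ψ e s (v j)‖ := by
    conv_rhs => rw [hv]
    exact hpick' _
  have h2 : ‖∑ x ∈ Finset.range s, constCoeff ψ e (s - (x + 1)) (v (j + (x + 1)))‖ ≤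
      ∑ x ∈ Finset.range s, c (s - (x + 1)) :=
    norm_sum_le_of_le _ fun x hx =>
      hc _ (by have := Finset.mem_range.1 hx; omega) _ (hv1 _)
  have h3 : taylorCoeff ζ e (j + s) (ψ (F 0)) =
      ∑ i : Fin j, constCoeff ψ e (j + s - i) (v i) +
      (∑ x ∈ Finset.range s, constCoeff ψ e (s - (x + 1)) (v (j + (x + 1))) +
        constCoeff ψ e s (v j)) := by
    rw [taylorCoeff_map_series ψ hh hF, add_assoc, Finset.sum_range_add, Finset.sum_range_succ',
      Finset.sum_range]
    simp [Nat.add_sub_add_left]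
  rw [h3, ← add_assoc]
  have h4 := norm_sub_le (∑ i : Fin j, constCoeff ψ e (j + s - i) (v i) +
      ∑ x ∈ Finset.range s, constCoeff ψ e (s - (x + 1)) (v (j + (x + 1))) +
        constCoeff ψ e s (v j)) (∑ i : Fin j, constCoeff ψ e (j + s - i) (v i) +
      ∑ x ∈ Finset.range s, constCoeff ψ e (s - (x + 1)) (v (j + (x + 1))))
  rw [add_sub_cancel_left] at h4
  have h5 := norm_add_le (∑ i : Fin j, constCoeff ψ e (j + s - i) (v i))
    (∑ x ∈ Finset.range s, constCoeff ψ e (s - (x + 1)) (v (j + (x + 1))))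
  linarith
end

theorem linearGerm_mem_mIdeal {X : Type*} [NormedAddCommGroup X] [NormedSpace ℂ X] (ζ : X)
    (h : X →L[ℂ] ℂ) : linearGerm ζ h ∈ mIdeal X ζ := by
  rw [mIdeal, RingHom.mem_ker, linearGerm, evalAt_analyticGerm, sub_self, map_zero]

theorem HasFPowerSeriesAt.exists_shift {X : Type*} [NormedAddCommGroup X] [NormedSpace ℂ X]
    {g : X → ℂ} {ζ : X} {p : FormalMultilinearSeries ℂ X ℂ} (hg : HasFPowerSeriesAt g p ζ) :
    ∃ G : X → X →L[ℂ] ℂ, HasFPowerSeriesAt G p.shift ζ ∧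
      ∀ᶠ y in 𝓝 ζ, g y = p 0 0 + G y (y - ζ) := by
  obtain ⟨r, hr⟩ := hg
  have h1 : HasFPowerSeriesOnBall (fun y => p.shift.sum (y - ζ)) p.shift ζ r := by
    have h2 : 0 < p.shift.radius := by
      rw [FormalMultilinearSeries.radius_shift]
      exact hr.r_pos.trans_le hr.r_le
    have h3 := (p.shift.hasFPowerSeriesOnBall h2).comp_sub ζ
    rw [zero_add] at h3
    exact h3.mono hr.r_pos (p.radius_shift.symm ▸ hr.r_le)
  refine ⟨_, ⟨r, h1⟩, ?_⟩
  have h4 := h1.unshift (z := p 0 0)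
  have h5 : p.shift.unshift (p 0 0) = p := by
    ext n v
    cases n with
    | zero => simp [FormalMultilinearSeries.unshift, Subsingleton.elim v 0]
    | succ n => simp [FormalMultilinearSeries.unshift, FormalMultilinearSeries.shift]
  rw [h5] at h4
  filter_upwards [Metric.eball_mem_nhds ζ hr.r_pos] with y hy
  exact hr.unique h4 hy

theorem analyticGerm_mem_mIdeal_pow {m : ℕ} {ζ : Fin m → ℂ} (s : ℕ) :
    ∀ {g : (Fin m → ℂ) → ℂ} (hg : AnalyticAt ℂ g ζ)
      {p : FormalMultilinearSeries ℂ (Fin m → ℂ) ℂ}, HasFPowerSeriesAt g p ζ →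
      (∀ k < s, p k = 0) → analyticGerm g hg ∈ mIdeal (Fin m → ℂ) ζ ^ s := by
  induction s with
  | zero => simp
  | succ s ih =>
    intro g hg p hp h0
    obtain ⟨G, hG, hgG⟩ := hp.exists_shift
    let ev (i : Fin m) : ((Fin m → ℂ) →L[ℂ] ℂ) →L[ℂ] ℂ :=
      ContinuousLinearMap.apply ℂ ℂ (Pi.single i 1)
    have hGi : ∀ i, HasFPowerSeriesAt (fun y => G y (Pi.single i 1))
        ((ev i).compFormalMultilinearSeries p.shift) ζ :=
      fun i => hG.imp fun _ hr => (ev i).comp_hasFPowerSeriesOnBall hr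
    have key : analyticGerm g hg = ∑ i, linearGerm ζ (ContinuousLinearMap.proj i) *
        analyticGerm (fun y => G y (Pi.single i 1)) (hGi i).analyticAt := by
      simp only [linearGerm, analyticGerm_mul]
      rw [analyticGerm_sum, analyticGerm_eq_iff]
      filter_upwards [hgG] with y hy
      rw [hy, h0 0 s.succ_pos]
      conv_lhs => rw [pi_eq_sum_univ' (y - ζ), map_sum]
      simp
    rw [key, pow_succ']
    refine Ideal.sum_mem _ fun i _ => Ideal.mul_mem_mul (linearGerm_mem_mIdeal ζ _) ?_
    refine ih _ (hGi i) fun k hk => ?_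
    ext v
    simp [ev, FormalMultilinearSeries.shift, h0 (k + 1) (by omega)]

theorem mem_mIdeal_pow_of_taylorCoeff_eq_zero {m : ℕ} [NeZero m] {ζ : Fin m → ℂ} {s : ℕ}
    {g : Oat (Fin m → ℂ) ζ} (h : ∀ k < s, ∀ e ≠ 0, taylorCoeff ζ e k g = 0) :
    g ∈ mIdeal (Fin m → ℂ) ζ ^ s := by
  obtain ⟨p, f, hf, ⟨r, hr⟩, rfl⟩ := exists_hasFPowerSeriesAt g
  have hdiag : ∀ k < s, ∀ e, (p k fun _ => e) = 0 := by
    intro k hk e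
    rcases eq_or_ne e 0 with rfl | he
    · rcases eq_or_ne k 0 with rfl | hk0
      · have h1 := h 0 hk 1 one_ne_zero
        rw [taylorCoeff_analyticGerm hf ⟨r, hr⟩] at h1
        rwa [Subsingleton.elim (fun _ : Fin 0 => (0 : Fin m → ℂ)) fun _ => 1]
      · have : NeZero k := ⟨hk0⟩
        exact (p k).map_zero
    · rw [← taylorCoeff_analyticGerm hf ⟨r, hr⟩]
      exact h k hk e he
  let q : FormalMultilinearSeries ℂ (Fin m → ℂ) ℂ := fun k => if k < s then 0 else p k
  have hq : HasFPowerSeriesOnBall f q ζ r := by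
    refine ⟨hr.r_le.trans (FormalMultilinearSeries.radius_le_of_le fun k => ?_), hr.r_pos,
      fun {y} hy => ?_⟩
    · by_cases hk : k < s <;> simp [q, hk]
    · have h1 : (fun k => q k fun _ => y) = fun k => p k fun _ => y := by
        funext k
        by_cases hk : k < s
        · simp [q, hk, hdiag k hk]
        · simp [q, hk]
      rw [h1]
      exact hr.hasSum hy
  exact analyticGerm_mem_mIdeal_pow s hf ⟨r, hq⟩ fun k hk => by simp [q, hk]

theorem LinearMap.continuous_of_ker_le {E ι : Type*} [NormedAddCommGroup E] [NormedSpace ℂ E]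
    {Θ : E →ₗ[ℂ] ι → ℂ} [FiniteDimensional ℂ (LinearMap.range Θ)]
    (hΘ : ∀ i, Continuous fun v => Θ v i) {L : E →ₗ[ℂ] ℂ}
    (hL : LinearMap.ker Θ ≤ LinearMap.ker L) : Continuous L := by
  obtain ⟨L', rfl⟩ : ∃ L' : LinearMap.range Θ →ₗ[ℂ] ℂ, L = L' ∘ₗ Θ.rangeRestrict :=
    ⟨((LinearMap.ker Θ).liftQ L hL) ∘ₗ Θ.quotKerEquivRange.symm.toLinearMap, by
      ext v
      exact congrArg ((LinearMap.ker Θ).liftQ L hL)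
        (Θ.quotKerEquivRange_symm_apply_image v ⟨v, rfl⟩).symm⟩
  exact L'.continuous_of_finiteDimensional.comp
    (Continuous.subtype_mk (continuous_pi hΘ) _)

theorem finiteDimensional_range_taylorCoeff {X : Type*} [NormedAddCommGroup X] [NormedSpace ℂ X]
    [FiniteDimensional ℂ X] (ζ : X) (s : ℕ) :
    FiniteDimensional ℂ (LinearMap.range
      (LinearMap.pi fun i : Fin s × {e : X // e ≠ 0} => taylorCoeff ζ i.2.1 i.1)) := by
  let Δ : (∀ k : Fin s, MultilinearMap ℂ (fun _ : Fin k => X) ℂ) →ₗ[ℂ]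
      (Fin s × {e : X // e ≠ 0} → ℂ) :=
    { toFun := fun f i => f i.1 fun _ => i.2.1
      map_add' := fun _ _ => rfl
      map_smul' := fun _ _ => rfl }
  refine Submodule.finiteDimensional_of_le (S₂ := LinearMap.range Δ) ?_
  rintro _ ⟨g, rfl⟩
  obtain ⟨p, f, hf, hp, rfl⟩ := exists_hasFPowerSeriesAt g
  refine ⟨fun k => (p k).toMultilinearMap, ?_⟩
  ext i
  simp [Δ, taylorCoeff_analyticGerm hf hp]

theorem continuous_of_mIdeal_pow_le_ker {E : Type*} [NormedAddCommGroup E] [NormedSpace ℂ E]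
    [CompleteSpace E] {m : ℕ} [NeZero m] {ζ : Fin m → ℂ}
    (ψ : OEat (Fin m → ℂ) E ζ →ₗ[Oat (Fin m → ℂ) ζ] Oat (Fin m → ℂ) ζ) (s : ℕ) {L : E →ₗ[ℂ] ℂ}
    (hL : ∀ v, constImage ψ v ∈ mIdeal (Fin m → ℂ) ζ ^ s → L v = 0) :
    Continuous L := by
  let Θ : E →ₗ[ℂ] (Fin s × {e : Fin m → ℂ // e ≠ 0} → ℂ) :=
    LinearMap.pi fun i => constCoeff ψ i.2.1 i.1
  have := finiteDimensional_range_taylorCoeff ζ s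
  have : FiniteDimensional ℂ (LinearMap.range Θ) := by
    refine Submodule.finiteDimensional_of_le (S₂ := LinearMap.range
      (LinearMap.pi fun i : Fin s × {e : Fin m → ℂ // e ≠ 0} => taylorCoeff ζ i.2.1 i.1)) ?_
    rintro _ ⟨v, rfl⟩
    exact ⟨constImage ψ v, rfl⟩
  refine LinearMap.continuous_of_ker_le (Θ := Θ) (fun i => continuous_constCoeff ψ i.2.2 i.1)
    fun v hv => hL v (mem_mIdeal_pow_of_taylorCoeff_eq_zero fun k hk e he => ?_)
  exact congrFun hv (⟨k, hk⟩, ⟨e, he⟩)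

/-- The homomorphism `g ↦ l (g ζ) • x` from a plain module attached to a linear form `l` and an
element `x` annihilated by the maximal ideal. -/
noncomputable def evalSMul {X E M : Type*} [NormedAddCommGroup X] [NormedSpace ℂ X]
    [NormedAddCommGroup E] [NormedSpace ℂ E] {ζ : X} [AddCommGroup M] [Module (Oat X ζ) M]
    (l : E →ₗ[ℂ] ℂ) (x : M) (hx : ∀ r ∈ mIdeal X ζ, r • x = 0) :
    OEat X E ζ →ₗ[Oat X ζ] M where
  toFun g := constHom ζ (l (germValue ζ (g : Germ (𝓝 ζ) E))) • x
  map_add' := by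
    rintro ⟨_, f, hf, rfl⟩ ⟨_, k, hk, rfl⟩
    rw [← add_smul, ← map_add, ← map_add]
    rfl
  map_smul' := by
    rintro a ⟨_, f, hf, rfl⟩
    obtain ⟨b, hb, rfl⟩ := exists_eq_analyticGerm a
    rw [RingHom.id_apply, ← sub_eq_zero, smul_smul, ← sub_smul]
    refine hx _ ?_
    rw [mIdeal, RingHom.mem_ker, map_sub, sub_eq_zero, map_mul]
    exact map_smul l (b ζ) (f ζ)

theorem continuous_of_evalSMul_eq_comp {E M : Type*} [NormedAddCommGroup E] [NormedSpace ℂ E]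
    [CompleteSpace E] {m n : ℕ} [NeZero m] {ζ : Fin m → ℂ} [AddCommGroup M]
    [Module (Oat (Fin m → ℂ) ζ) M] [Module ℂ M] [IsScalarTower ℂ (Oat (Fin m → ℂ) ζ) M]
    {l : E →ₗ[ℂ] ℂ} {x : M} (hx : ∀ r ∈ mIdeal (Fin m → ℂ) ζ, r • x = 0) {s : ℕ}
    (hs : x ∉ (mIdeal (Fin m → ℂ) ζ ^ s • ⊤ : Submodule (Oat (Fin m → ℂ) ζ) M))
    {p : (Fin n → Oat (Fin m → ℂ) ζ) →ₗ[Oat (Fin m → ℂ) ζ] M}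
    {ψ : OEat (Fin m → ℂ) E ζ →ₗ[Oat (Fin m → ℂ) ζ] (Fin n → Oat (Fin m → ℂ) ζ)}
    (hψ : evalSMul l x hx = p ∘ₗ ψ) : Continuous l := by
  obtain ⟨μ, hμx, hμ⟩ := Submodule.exists_le_ker_of_notMem
    (p := (mIdeal (Fin m → ℂ) ζ ^ s • ⊤ : Submodule (Oat (Fin m → ℂ) ζ) M).restrictScalars ℂ) hs
  let L (i : Fin n) : E →ₗ[ℂ] ℂ := μ ∘ₗ
    (LinearMap.toSpanSingleton (Oat (Fin m → ℂ) ζ) M (p (Pi.single i 1))).restrictScalars ℂ ∘ₗ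
      constImage (LinearMap.proj i ∘ₗ ψ)
  have hL : ∀ i, Continuous (L i) := fun i =>
    continuous_of_mIdeal_pow_le_ker (LinearMap.proj i ∘ₗ ψ) s fun v hv => by
      have h : constImage (LinearMap.proj i ∘ₗ ψ) v • p (Pi.single i 1) ∈
          (mIdeal (Fin m → ℂ) ζ ^ s • ⊤ : Submodule (Oat (Fin m → ℂ) ζ) M) :=
        Submodule.smul_mem_smul hv Submodule.mem_top
      exact LinearMap.mem_ker.1 (hμ h)
  have hsum : ∀ v, l v = (μ x)⁻¹ * ∑ i, L i v := by
    intro v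
    have h1 : l v • x = ∑ i, ψ (constGerm (Fin m → ℂ) E ζ v) i • p (Pi.single i 1) := by
      rw [← algebraMap_smul (Oat (Fin m → ℂ) ζ)]
      refine (LinearMap.congr_fun hψ (constGerm (Fin m → ℂ) E ζ v)).trans ?_
      rw [LinearMap.comp_apply]
      conv_lhs => rw [pi_eq_sum_univ' (ψ (constGerm (Fin m → ℂ) E ζ v)), map_sum]
      simp only [map_smul]
    have h2 := congrArg μ h1
    rw [map_smul, smul_eq_mul, map_sum] at h2
    rw [eq_inv_mul_iff_mul_eq₀ hμx, mul_comm, h2]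
    rfl
  rw [funext hsum]
  exact continuous_const.mul (continuous_finsetSum _ fun i _ => hL i)

/-- **Theorem 5.1.** If `M ≠ 0` is a finite `O_ζ`-module of `m_ζ`-depth zero
and `p : O_ζ^n → M` is an epimorphism, then for every infinite dimensional Banach space `E`
there is an `O_ζ`-homomorphism `O^E_ζ → M` that does not factor through `p`. -/
theorem exists_nonfactorizable_hom
    (m n : ℕ) (hm : 1 ≤ m) (hn : 1 ≤ n) (ζ : Fin m → ℂ)
    [CompleteSpace E] (hE : ¬FiniteDimensional ℂ E)
    (M : Type*) [AddCommGroup M] [Module (Oat (Fin m → ℂ) ζ) M]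
    [Module.Finite (Oat (Fin m → ℂ) ζ) M] [Nontrivial M]
    (hdepth : ¬IsDepthPos (Oat (Fin m → ℂ) ζ) (mIdeal (Fin m → ℂ) ζ) M)
    (p : (Fin n → Oat (Fin m → ℂ) ζ) →ₗ[Oat (Fin m → ℂ) ζ] M)
    (hp : Function.Surjective p) :
    ∃ φ : OEat (Fin m → ℂ) E ζ →ₗ[Oat (Fin m → ℂ) ζ] M,
      ∀ ψ : OEat (Fin m → ℂ) E ζ →ₗ[Oat (Fin m → ℂ) ζ] (Fin n → Oat (Fin m → ℂ) ζ),
        φ ≠ p ∘ₗ ψ := by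
  have : NeZero m := ⟨by omega⟩
  have := isNoetherianRing_Oat ζ
  obtain ⟨x, hx0, hx⟩ := exists_ne_zero_smul_eq_zero_of_not_isDepthPos hdepth
  obtain ⟨s, hs⟩ : ∃ s, x ∉ (mIdeal (Fin m → ℂ) ζ ^ s • ⊤ : Submodule (Oat (Fin m → ℂ) ζ) M) := by
    by_contra! h
    obtain ⟨r, hr⟩ := (Ideal.mem_iInf_smul_pow_eq_bot_iff _ x).1 ((Submodule.mem_iInf _).2 h)
    exact hx0 (hr.symm.trans (hx r r.2))
  obtain ⟨l, hl⟩ := exists_not_continuous_linearMap hE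
  let : Module ℂ M := Module.compHom M (constHom ζ)
  have : IsScalarTower ℂ (Oat (Fin m → ℂ) ζ) M := IsScalarTower.of_algebraMap_smul fun _ _ => rfl
  exact ⟨evalSMul l x hx, fun ψ hψ => hl (continuous_of_evalSMul_eq_comp hx hs hψ)⟩
end

section
/- Let ζ ∈ ℂ^m with 1 ≤ m < ∞ and E an infinite-dimensional complex Banach space. Then the O_ζ-module O^E_ζ of germs at ζ of E-valued holomorphic functions cannot be embedded as a submodule of any free O_ζ-module; in particular O^E_ζ is not free. -/
open Filter Topology

variable (X : Type*) [NormedAddCommGroup X] [NormedSpace ℂ X]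

variable (E : Type*) [NormedAddCommGroup E] [NormedSpace ℂ E]

/-- Let `φ i` be a pointwise finite family of functionals on a module in which the lacunary series
`∑ w ^ n k • c k` with `c k ∈ S` have sums `w`-adically. If the ring is `w`-adically separated and
`w` is a nonzerodivisor, then only finitely many `φ i` are nonzero on `S`. -/
theorem finite_setOf_exists_mem_apply_ne_zero {R M ι : Type*} [CommRing R] [AddCommGroup M]
    [Module R M] (φ : ι → M →ₗ[R] R) (hφ : ∀ x, {i | φ i x ≠ 0}.Finite) {w : R}
    (hw : ∀ r, w * r = 0 → r = 0) (hsep : ∀ r, (∀ n, w ^ n ∣ r) → r = 0) (S : Set M)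
    (hS : ∀ (n : ℕ → ℕ) (c : ℕ → M), StrictMono n → (∀ k, c k ∈ S) →
      ∃ g, ∀ K, ∃ h, g = ∑ k ∈ Finset.range K, w ^ n k • c k + w ^ n K • h) :
    {i | ∃ c ∈ S, φ i c ≠ 0}.Finite := by
  by_contra hinf
  have hwpow : ∀ (n : ℕ) (r : R), w ^ n * r = 0 → r = 0 := by
    intro n
    induction n with
    | zero => intro r hr; simpa using hr
    | succ n ih => intro r hr; exact hw r (ih _ (by rw [← hr]; ring))
  have hstep : ∀ p : M × ℕ, ∃ c ∈ S, ∃ (i : ι) (N : ℕ), φ i p.1 = 0 ∧ p.2 < N ∧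
      ¬ w ^ N ∣ w ^ p.2 * φ i c := by
    rintro ⟨s, n⟩
    obtain ⟨i, ⟨c, hc, hic⟩, hi⟩ := Set.Infinite.exists_notMem_finite hinf (hφ s)
    have hne : ¬ ∀ N, w ^ N ∣ w ^ n * φ i c := fun h => hic (hwpow n _ (hsep _ h))
    push Not at hne
    obtain ⟨N, hN⟩ := hne
    refine ⟨c, hc, i, N + n + 1, by simpa using hi, by simp only; omega, fun h => hN ?_⟩
    exact (pow_dvd_pow w (by omega)).trans h
  choose c hcS i N hi hN hdvd using hstep
  let st : ℕ → M × ℕ := fun k => Nat.rec (0, 0) (fun _ p => (p.1 + w ^ p.2 • c p, N p)) k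
  have hst : ∀ k, st (k + 1) = ((st k).1 + w ^ (st k).2 • c (st k), N (st k)) := fun _ => rfl
  have hmono : StrictMono fun k => (st k).2 :=
    strictMono_nat_of_lt_succ fun k => by simpa only [hst] using hN (st k)
  obtain ⟨g, hg⟩ := hS (fun k => (st k).2) (fun k => c (st k)) hmono fun k => hcS _
  have hsum : ∀ K, (st K).1 = ∑ k ∈ Finset.range K, w ^ (st k).2 • c (st k) := by
    intro K
    induction K with
    | zero => rfl
    | succ K ih => rw [Finset.sum_range_succ, ← ih, hst]
  have hg' : ∀ K, ∃ h, g = (st K).1 + w ^ (st K).2 • h := fun K => by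
    rw [hsum]; exact hg K
  have hndvd : ∀ k, ¬ w ^ (st (k + 1)).2 ∣ φ (i (st k)) g := by
    intro k hk
    obtain ⟨h, hh⟩ := hg' (k + 1)
    rw [hh, map_add, map_smul, smul_eq_mul, dvd_add_left (Dvd.intro _ rfl), hst, map_add, hi,
      zero_add, map_smul, smul_eq_mul] at hk
    exact hdvd _ hk
  have hlt : ∀ j k, j < k → i (st j) ≠ i (st k) := by
    intro j k hjk heq
    obtain ⟨h, hh⟩ := hg' k
    apply hndvd j
    rw [heq, hh, map_add, hi, zero_add, map_smul, smul_eq_mul]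
    exact Dvd.dvd.mul_right (pow_dvd_pow w (hmono.monotone hjk)) _
  have hinj : Function.Injective fun k => i (st k) := by
    intro j k hjk
    rcases lt_trichotomy j k with h | h | h
    · exact (hlt _ _ h hjk).elim
    · exact h
    · exact (hlt _ _ h hjk.symm).elim
  refine Set.infinite_of_injective_forall_mem hinj (fun k => ?_) (hφ g)
  intro h0
  exact hndvd k (by rw [h0]; exact dvd_zero _)

/-- A linear map into a free module cannot be injective if its coordinates that do not vanish
on `S` are finite in number while `S` contains arbitrarily large independent families. -/
theorem not_injective_of_finite_coords {R M N ι : Type*} [CommRing R] [Nontrivial R]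
    [AddCommGroup M] [Module R M] [AddCommGroup N] [Module R N] (b : Module.Basis ι R N)
    (f : M →ₗ[R] N) (S : Set M) (hfin : {i | ∃ c ∈ S, b.coord i (f c) ≠ 0}.Finite)
    (hS : ∀ n : ℕ, ∃ e : Fin n → M, (∀ ν, e ν ∈ S) ∧ LinearIndependent R e) :
    ¬ Function.Injective f := by
  intro hf
  let F := hfin.toFinset
  obtain ⟨e, heS, he⟩ := hS (F.card + 1)
  have hli : LinearIndependent R fun ν => fun j : F => b.coord j (f (e ν)) := by
    rw [Fintype.linearIndependent_iff] at he ⊢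
    intro a ha
    refine he a (hf (b.ext_elem fun j => ?_))
    rw [map_zero, map_zero, ← b.coord_apply, map_sum, map_sum]
    by_cases hj : j ∈ F
    · simpa using congrFun ha ⟨j, hj⟩
    · refine Finset.sum_eq_zero fun ν _ => ?_
      have : b.coord j (f (e ν)) = 0 := by
        by_contra h
        exact hj (hfin.mem_toFinset.2 ⟨e ν, heS ν, h⟩)
      rw [map_smul, map_smul, this, smul_zero]
  have := hli.fintype_card_le_finrank
  simp at this

/-- The germ at `ζ` of the affine function `z ↦ ℓ (z - ζ)`. -/
noncomputable def coordGerm (ζ : X) (ℓ : X →L[ℂ] ℂ) : Oat X ζ :=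
  ⟨((fun z => ℓ (z - ζ) : X → ℂ) : Filter.Germ (𝓝 ζ) ℂ), fun z => ℓ (z - ζ),
    (ℓ.analyticAt _).comp (analyticAt_id.sub analyticAt_const), rfl⟩

theorem eq_zero_of_coordGerm_mul_eq_zero (ζ : X) (ℓ : X →L[ℂ] ℂ) (hℓ : ℓ ≠ 0) (r : Oat X ζ)
    (h : coordGerm X ζ ℓ * r = 0) : r = 0 := by
  obtain ⟨_, a, ha, rfl⟩ := r
  have h' : ∀ᶠ z in 𝓝 ζ, ℓ (z - ζ) * a z = 0 := Filter.Germ.coe_eq.1 (congrArg Subtype.val h)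
  refine Subtype.ext (Filter.Germ.coe_eq.2 ?_)
  have hd : Dense {z | ℓ z ≠ ℓ ζ} :=
    (dense_compl_singleton (ℓ ζ)).preimage (ℓ.isOpenMap_of_ne_zero hℓ)
  filter_upwards [h'.eventually_nhds, ha.eventually_analyticAt] with z hz haz
  have hfr : ∃ᶠ y in 𝓝 z, a y = 0 := by
    refine ((mem_closure_iff_frequently.1 (hd z)).and_eventually hz).mono ?_
    rintro y ⟨hy, hy0⟩
    refine (mul_eq_zero.1 hy0).resolve_left ?_
    rw [map_sub]
    exact sub_ne_zero.2 hy
  by_contra hne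
  exact hfr (haz.continuousAt.eventually_ne hne)

theorem eq_zero_of_forall_coordGerm_pow_dvd (ζ : X) (ℓ : X →L[ℂ] ℂ) (r : Oat X ζ)
    (h : ∀ n, coordGerm X ζ ℓ ^ n ∣ r) : r = 0 := by
  obtain ⟨_, a, ha, rfl⟩ := r
  refine Subtype.ext (Filter.Germ.coe_eq.2 ?_)
  obtain ⟨ε, hε, hball⟩ := Metric.eventually_nhds_iff_ball.1 ha.eventually_analyticAt
  filter_upwards [Metric.ball_mem_nhds ζ hε] with z hz
  let L : ℂ → X := fun t => ζ + t • (z - ζ)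
  have hL0 : L 0 = ζ := by simp [L]
  have hL1 : L 1 = z := by simp [L]
  have hLan : ∀ t, AnalyticAt ℂ L t := fun t =>
    analyticAt_const.add (analyticAt_id.smul analyticAt_const)
  have hconv : Convex ℝ (L ⁻¹' Metric.ball ζ ε) := by
    have : L ⁻¹' Metric.ball ζ ε = (fun t : ℂ => t • (z - ζ)) ⁻¹' Metric.ball 0 ε := by
      ext t; simp [L, dist_eq_norm]
    rw [this]
    exact (convex_ball 0 ε).is_linear_preimage
      ⟨fun s t => add_smul s t _, fun s t => smul_assoc s t _⟩
  have hoan : AnalyticOnNhd ℂ (a ∘ L) (L ⁻¹' Metric.ball ζ ε) := fun t ht =>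
    (hball _ ht).comp (hLan t)
  have hmem0 : (0 : ℂ) ∈ L ⁻¹' Metric.ball ζ ε := by simpa [L] using hε
  have hmem1 : (1 : ℂ) ∈ L ⁻¹' Metric.ball ζ ε := by simpa only [Set.mem_preimage, hL1] using hz
  have horder : ∀ n : ℕ, (n : ℕ∞) ≤ analyticOrderAt (a ∘ L) 0 := by
    intro n
    rw [natCast_le_analyticOrderAt (hoan 0 hmem0)]
    obtain ⟨⟨_, k, hk, rfl⟩, hak⟩ := h n
    have hak' : ∀ᶠ y in 𝓝 ζ, a y = ℓ (y - ζ) ^ n * k y :=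
      Filter.Germ.coe_eq.1 (congrArg Subtype.val hak)
    refine ⟨fun t => ℓ (z - ζ) ^ n * k (L t), ?_, ?_⟩
    · exact analyticAt_const.mul (AnalyticAt.comp (hL0.symm ▸ hk) (hLan 0))
    · have hcont : Tendsto L (𝓝 0) (𝓝 ζ) := by
        simpa only [ContinuousAt, hL0] using (hLan 0).continuousAt
      filter_upwards [hcont.eventually hak'] with t ht
      rw [Function.comp_apply, ht]
      simp [L, mul_pow, mul_assoc]
  have htop : analyticOrderAt (a ∘ L) 0 = ⊤ := ENat.eq_top_iff_forall_ge.2 horder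
  have := hoan.eqOn_zero_of_preconnected_of_eventuallyEq_zero hconv.isPreconnected hmem0
    (analyticOrderAt_eq_top.1 htop) hmem1
  simpa [hL1] using this

theorem summable_pow_smul_of_le {n : ℕ → ℕ} (hn : ∀ k, k ≤ n k) [CompleteSpace E] {c : ℕ → E}
    (hc : ∀ k, ‖c k‖ ≤ 1) {u : ℂ} (hu : ‖u‖ < 1) : Summable fun k => u ^ n k • c k := by
  refine Summable.of_norm_bounded (summable_geometric_of_lt_one (norm_nonneg u) hu) fun k => ?_
  rw [norm_smul, norm_pow]
  calc ‖u‖ ^ n k * ‖c k‖ ≤ ‖u‖ ^ k * 1 :=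
        mul_le_mul (pow_le_pow_of_le_one (norm_nonneg u) hu.le (hn k)) (hc k)
          (norm_nonneg _) (by positivity)
    _ = ‖u‖ ^ k := mul_one _

theorem analyticAt_tsum_pow_smul {n : ℕ → ℕ} (hn : ∀ k, k ≤ n k) [CompleteSpace E] {c : ℕ → E}
    (hc : ∀ k, ‖c k‖ ≤ 1) : AnalyticAt ℂ (fun u : ℂ => ∑' k, u ^ n k • c k) 0 := by
  have hd : DifferentiableOn ℂ (fun u : ℂ => ∑' k, u ^ n k • c k) (Metric.ball 0 (1 / 2)) := by
    refine Complex.differentiableOn_tsum_of_summable_norm (u := fun k => (1 / 2 : ℝ) ^ k)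
      (summable_geometric_of_lt_one (by norm_num) (by norm_num)) (fun k => by fun_prop)
      Metric.isOpen_ball fun k u hu => ?_
    have hu' : ‖u‖ ≤ 1 / 2 := by simpa using (mem_ball_zero_iff.1 hu).le
    rw [norm_smul, norm_pow]
    calc ‖u‖ ^ n k * ‖c k‖ ≤ (1 / 2) ^ k * 1 :=
          mul_le_mul ((pow_le_pow_of_le_one (norm_nonneg u) (by linarith) (hn k)).trans
            (pow_le_pow_left₀ (norm_nonneg u) hu' k)) (hc k) (norm_nonneg _) (by positivity)
      _ = (1 / 2) ^ k := mul_one _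
  exact hd.analyticAt (Metric.ball_mem_nhds 0 (by norm_num))

/-- Lacunary series with coefficients in the unit ball of `E` converge in `O^E_ζ`. -/
theorem exists_lacunary_sum [CompleteSpace E] (ζ : X) (ℓ : X →L[ℂ] ℂ) {n : ℕ → ℕ}
    (hn : StrictMono n) {c : ℕ → E} (hc : ∀ k, ‖c k‖ ≤ 1) :
    ∃ g : OEat X E ζ, ∀ K, ∃ h, g = ∑ k ∈ Finset.range K,
      coordGerm X ζ ℓ ^ n k • constGerm X E ζ (c k) + coordGerm X ζ ℓ ^ n K • h := by
  have hsub : AnalyticAt ℂ (fun z => ℓ (z - ζ)) ζ :=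
    (ℓ.analyticAt _).comp (analyticAt_id.sub analyticAt_const)
  have hζ : ℓ (ζ - ζ) = 0 := by simp
  have htail : ∀ K j, j ≤ n (j + K) - n K := fun K j =>
    Nat.le_sub_of_add_le (hn.add_le_nat j K)
  have han : ∀ (p : ℕ → ℕ) (d : ℕ → E), (∀ k, k ≤ p k) → (∀ k, ‖d k‖ ≤ 1) →
      AnalyticAt ℂ (fun z => ∑' k, ℓ (z - ζ) ^ p k • d k) ζ := fun p d hp hd =>
    AnalyticAt.comp (g := fun u : ℂ => ∑' k, u ^ p k • d k)
      (hζ.symm ▸ analyticAt_tsum_pow_smul E hp hd) hsub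
  refine ⟨germOf X E ζ _ (han n c (fun _ => hn.le_apply) hc), fun K =>
    ⟨germOf X E ζ _ (han _ (fun j => c (j + K)) (htail K) fun j => hc _), ?_⟩⟩
  have hcoe : ∀ K, ((∑ k ∈ Finset.range K,
      coordGerm X ζ ℓ ^ n k • constGerm X E ζ (c k) : OEat X E ζ) : Filter.Germ (𝓝 ζ) E) =
      ((fun z => ∑ k ∈ Finset.range K, ℓ (z - ζ) ^ n k • c k : X → E) :
        Filter.Germ (𝓝 ζ) E) := by
    intro K
    induction K with
    | zero => rfl
    | succ K ih =>
      simp only [Finset.sum_range_succ]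
      rw [Submodule.coe_add, ih]
      rfl
  apply Subtype.ext
  rw [Submodule.coe_add, hcoe]
  refine Filter.Germ.coe_eq.2 ?_
  have hsmall : ∀ᶠ z in 𝓝 ζ, ‖ℓ (z - ζ)‖ < 1 :=
    hsub.continuousAt.norm.eventually_lt continuousAt_const (by simp)
  filter_upwards [hsmall] with z hz
  rw [← (summable_pow_smul_of_le E (fun _ => hn.le_apply) hc hz).sum_add_tsum_nat_add K]
  change _ = _ + ℓ (z - ζ) ^ n K • ∑' j, ℓ (z - ζ) ^ (n (j + K) - n K) • c (j + K)
  rw [← (summable_pow_smul_of_le E (htail K) (fun j => hc (j + K)) hz).tsum_const_smul]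
  congr 1
  refine tsum_congr fun j => ?_
  rw [smul_smul, ← pow_add, Nat.add_sub_cancel' (hn.monotone (Nat.le_add_left K j))]

theorem linearIndependent_constGerm (ζ : X) {κ : Type*} [Finite κ] {e : κ → E}
    (he : LinearIndependent ℂ e) :
    LinearIndependent (Oat X ζ) fun ν => constGerm X E ζ (e ν) := by
  classical
  cases nonempty_fintype κ
  rw [Fintype.linearIndependent_iff] at he ⊢
  intro a ha
  choose α hα hαa using fun ν => (a ν).2
  have hcoe : ∀ T : Finset κ, ((∑ ν ∈ T, a ν • constGerm X E ζ (e ν) : OEat X E ζ) :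
      Filter.Germ (𝓝 ζ) E) =
      ((fun z => ∑ ν ∈ T, α ν z • e ν : X → E) : Filter.Germ (𝓝 ζ) E) := by
    intro T
    induction T using Finset.induction_on with
    | empty => rfl
    | insert ν T hν ih =>
      simp only [Finset.sum_insert hν]
      rw [Submodule.coe_add, ih]
      change (a ν : Filter.Germ (𝓝 ζ) ℂ) • (((fun _ => e ν : X → E)) : Filter.Germ (𝓝 ζ) E) + _ = _
      rw [hαa]
      rfl
  have hzero : ∀ᶠ z in 𝓝 ζ, ∑ ν, α ν z • e ν = 0 :=
    Filter.Germ.coe_eq.1 ((hcoe _).symm.trans (congrArg Subtype.val ha))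
  intro ν
  refine Subtype.ext ((hαa ν).trans (Filter.Germ.coe_eq.2 ?_))
  filter_upwards [hzero] with z hz
  exact he _ hz ν

theorem exists_linearIndependent_norm_le_one (hE : ¬FiniteDimensional ℂ E) (n : ℕ) :
    ∃ e : Fin n → E, (∀ ν, ‖e ν‖ ≤ 1) ∧ LinearIndependent ℂ e := by
  have hrank : (n : Cardinal) ≤ Module.rank ℂ E :=
    (Cardinal.natCast_lt_aleph0).le.trans
      (not_lt.1 fun h => hE (Module.rank_lt_aleph0_iff.1 h))
  obtain ⟨e, he⟩ := exists_linearIndependent_of_le_rank hrank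
  let u : Fin n → ℂˣ := fun ν => Units.mk0 (‖e ν‖⁻¹ : ℂ) (by simpa using he.ne_zero ν)
  refine ⟨u • e, fun ν => ?_, he.units_smul u⟩
  have : ‖(‖e ν‖⁻¹ : ℂ) • e ν‖ = 1 := norm_smul_inv_norm (he.ne_zero ν)
  exact this.le

/-- An `O_ζ`-linear map from `O^E_ζ` to a free module is not injective. -/
theorem not_injective_of_free [Nontrivial X] [CompleteSpace E] (hE : ¬FiniteDimensional ℂ E)
    (ζ : X) {N : Type*} [AddCommGroup N] [Module (Oat X ζ) N] [Module.Free (Oat X ζ) N]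
    (f : OEat X E ζ →ₗ[Oat X ζ] N) : ¬ Function.Injective f := by
  obtain ⟨v, hv⟩ := exists_ne (0 : X)
  obtain ⟨ℓ, -, hℓv⟩ := exists_dual_vector ℂ v (norm_ne_zero_iff.2 hv)
  have hℓ : ℓ ≠ 0 := by
    rintro rfl
    simp [hv, eq_comm] at hℓv
  have : Nontrivial (Oat X ζ) := (evalAt X ζ).domain_nontrivial
  let b := Module.Free.chooseBasis (Oat X ζ) N
  refine not_injective_of_finite_coords b f (constGerm X E ζ '' Metric.closedBall 0 1) ?_ ?_
  · refine finite_setOf_exists_mem_apply_ne_zero (fun i => b.coord i ∘ₗ f) (fun x => ?_)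
      (eq_zero_of_coordGerm_mul_eq_zero X ζ ℓ hℓ) (eq_zero_of_forall_coordGerm_pow_dvd X ζ ℓ) _ ?_
    · exact (b.repr (f x)).hasFiniteSupport
    · intro n c hn hc
      choose d hd hdc using hc
      obtain rfl : (fun k => constGerm X E ζ (d k)) = c := funext hdc
      exact exists_lacunary_sum X E ζ ℓ hn fun k => mem_closedBall_zero_iff.1 (hd k)
  · intro n
    obtain ⟨e, he, hli⟩ := exists_linearIndependent_norm_le_one E hE n
    exact ⟨fun ν => constGerm X E ζ (e ν),
      fun ν => ⟨e ν, mem_closedBall_zero_iff.2 (he ν), rfl⟩,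
      linearIndependent_constGerm X E ζ hli⟩

/-- **Corollary 1.4.** For `ζ ∈ ℂ^m`, `1 ≤ m`, and `E` infinite dimensional,
the plain module `O^E_ζ` cannot be embedded in any free `O_ζ`-module; in particular it is
not free. -/
theorem plain_module_not_embeddable_in_free
    (m : ℕ) (hm : 1 ≤ m) (ζ : Fin m → ℂ)
    [CompleteSpace E] (hE : ¬FiniteDimensional ℂ E) :
    (∀ (N : Type) [AddCommGroup N] [Module (Oat (Fin m → ℂ) ζ) N],
      Module.Free (Oat (Fin m → ℂ) ζ) N →
      ∀ f : OEat (Fin m → ℂ) E ζ →ₗ[Oat (Fin m → ℂ) ζ] N, ¬Function.Injective f) ∧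
    ¬Module.Free (Oat (Fin m → ℂ) ζ) (OEat (Fin m → ℂ) E ζ) := by
  have : Nonempty (Fin m) := ⟨⟨0, hm⟩⟩
  refine ⟨fun N _ _ _ f => not_injective_of_free _ E hE ζ f, fun _ => ?_⟩
  exact not_injective_of_free _ E hE ζ LinearMap.id Function.injective_id
end

section
/- Let E, F be complex Banach spaces, X a complex Banach space with dim X > 0, and φ : O^E_0 → O^F_0 an O_0-module homomorphism of germ modules at 0 ∈ X. Then there exists a plain homomorphism ψ : O^E_0 → O^F_0 (induced by a Hom(E,F)-valued holomorphic germ Φ at 0) such that φ and ψ agree on all constant germs. -/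
open Filter Topology

variable (X : Type*) [NormedAddCommGroup X] [NormedSpace ℂ X]

variable (E : Type*) [NormedAddCommGroup E] [NormedSpace ℂ E]

section TaylorSeries

variable {V G H : Type*} [NormedAddCommGroup V] [NormedSpace ℂ V]
  [NormedAddCommGroup G] [NormedSpace ℂ G] [NormedAddCommGroup H] [NormedSpace ℂ H]

/-- The Taylor series at `0`, with symmetric coefficients. -/
noncomputable def taylorAtZero (f : V → G) : FormalMultilinearSeries ℂ V G :=
  fun n => (n.factorial : ℂ)⁻¹ • iteratedFDeriv ℂ n f 0

lemma taylorAtZero_congr {f g : V → G} (h : f =ᶠ[𝓝 0] g) : taylorAtZero f = taylorAtZero g := by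
  funext n
  simp only [taylorAtZero, (h.iteratedFDeriv (𝕜 := ℂ) n).self_of_nhds]

lemma taylorAtZero_add [CompleteSpace G] {f g : V → G} (hf : AnalyticAt ℂ f 0)
    (hg : AnalyticAt ℂ g 0) (n : ℕ) :
    taylorAtZero (f + g) n = taylorAtZero f n + taylorAtZero g n := by
  simp only [taylorAtZero]
  rw [iteratedFDeriv_add_apply hf.contDiffAt hg.contDiffAt, smul_add]

lemma taylorAtZero_const_smul [CompleteSpace G] {f : V → G} (hf : AnalyticAt ℂ f 0) (c : ℂ)
    (n : ℕ) : taylorAtZero (c • f) n = c • taylorAtZero f n := by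
  simp only [taylorAtZero]
  rw [iteratedFDeriv_const_smul_apply hf.contDiffAt, smul_comm]

lemma taylorAtZero_comp_perm [CompleteSpace G] {f : V → G} (hf : AnalyticAt ℂ f 0) {n : ℕ}
    (v : Fin n → V) (σ : Equiv.Perm (Fin n)) :
    taylorAtZero f n (v ∘ σ) = taylorAtZero f n v := by
  have h := hf.contDiffAt (n := ⊤) |>.iteratedFDeriv_comp_perm v σ
  simp only [taylorAtZero, _root_.smul_apply, h]

lemma taylorAtZero_apply_diag [CompleteSpace G] {f : V → G} {p : FormalMultilinearSeries ℂ V G}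
    (hp : HasFPowerSeriesAt f p 0) (n : ℕ) (y : V) :
    taylorAtZero f n (fun _ => y) = p n (fun _ => y) := by
  obtain ⟨r, hr⟩ := hp
  have hn : (n.factorial : ℂ) ≠ 0 := by exact_mod_cast n.factorial_ne_zero
  rw [taylorAtZero, _root_.smul_apply, ← hr.factorial_smul y n,
    ← Nat.cast_smul_eq_nsmul ℂ, smul_smul, inv_mul_cancel₀ hn, one_smul]

lemma norm_taylorAtZero_le [CompleteSpace G] {f : V → G} {p : FormalMultilinearSeries ℂ V G}
    (hp : HasFPowerSeriesAt f p 0) (n : ℕ) : ‖taylorAtZero f n‖ ≤ ‖p n‖ := by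
  obtain ⟨r, hr⟩ := hp
  refine ContinuousMultilinearMap.opNorm_le_bound (norm_nonneg _) fun v => ?_
  have hn : (0 : ℝ) < n.factorial := by exact_mod_cast n.factorial_pos
  rw [taylorAtZero, _root_.smul_apply,
    hr.iteratedFDeriv_eq_sum_of_completeSpace, norm_smul, norm_inv, Complex.norm_natCast,
    inv_mul_le_iff₀ hn]
  refine (norm_sum_le_of_le (f := fun σ : Equiv.Perm (Fin n) => p n fun i => v (σ i)) _
    (fun σ _ => (p n).le_opNorm _)).trans (le_of_eq ?_)
  simp [Equiv.prod_comp _ fun i => ‖v i‖, Fintype.card_perm]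

lemma exists_norm_taylorAtZero_le [CompleteSpace G] {f : V → G} (hf : AnalyticAt ℂ f 0) :
    ∃ m : ℕ, ∀ n, ‖taylorAtZero f n‖ ≤ (m : ℝ) ^ (n + 1) := by
  obtain ⟨p, hp⟩ := hf
  obtain ⟨C, r, hC, hr, h⟩ := p.le_mul_pow_of_radius_pos hp.radius_pos
  obtain ⟨m, hm⟩ := exists_nat_ge (max C r)
  refine ⟨m, fun n => (norm_taylorAtZero_le hp n).trans ((h n).trans ?_)⟩
  rw [pow_succ']
  have h1 := (le_max_left _ _).trans hm
  have h2 := (le_max_right _ _).trans hm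
  gcongr

lemma hasSum_taylorAtZero [CompleteSpace G] {f : V → G} (hf : AnalyticAt ℂ f 0) :
    ∀ᶠ y in 𝓝 (0 : V), HasSum (fun n => taylorAtZero f n fun _ => y) (f y) := by
  obtain ⟨p, hp⟩ := hf
  obtain ⟨r, hr⟩ := id hp
  filter_upwards [hr.eventually_hasSum] with y hy
  simpa only [taylorAtZero_apply_diag hp, zero_add] using hy

lemma hasSum_taylorAtZero_line [CompleteSpace G] {f : V → G} (hf : AnalyticAt ℂ f 0) (x : V) :
    ∀ᶠ t in 𝓝 (0 : ℂ), HasSum (fun n => t ^ n • taylorAtZero f n fun _ => x) (f (t • x)) := by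
  have h : Tendsto (fun t : ℂ => t • x) (𝓝 0) (𝓝 0) := by
    have : Continuous fun t : ℂ => t • x := by fun_prop
    simpa using this.tendsto 0
  filter_upwards [h.eventually (hasSum_taylorAtZero hf)] with t ht
  convert ht using 2 with n
  simpa using ((taylorAtZero f n).map_smul_univ (fun _ => t) fun _ => x).symm

/-- The one-variable formal power series `∑ tⁿ cₙ`. -/
noncomputable def powerSeriesOfCoeff (c : ℕ → G) : FormalMultilinearSeries ℂ ℂ G :=
  fun n => ContinuousMultilinearMap.mkPiRing ℂ (Fin n) (c n)

@[simp]
lemma coeff_powerSeriesOfCoeff (c : ℕ → G) (n : ℕ) : (powerSeriesOfCoeff c).coeff n = c n := by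
  simp [FormalMultilinearSeries.coeff, powerSeriesOfCoeff]

lemma hasFPowerSeriesAt_of_hasSum_pow_smul {g : ℂ → G} {c : ℕ → G}
    (h : ∀ᶠ t in 𝓝 (0 : ℂ), HasSum (fun n => t ^ n • c n) (g t)) :
    HasFPowerSeriesAt g (powerSeriesOfCoeff c) 0 := by
  refine hasFPowerSeriesAt_iff.2 ?_
  simpa using h

lemma coeff_unique_of_hasSum_pow_smul {g : ℂ → G} {c d : ℕ → G}
    (hc : ∀ᶠ t in 𝓝 (0 : ℂ), HasSum (fun n => t ^ n • c n) (g t))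
    (hd : ∀ᶠ t in 𝓝 (0 : ℂ), HasSum (fun n => t ^ n • d n) (g t)) : c = d := by
  have h := (hasFPowerSeriesAt_of_hasSum_pow_smul hc).eq_formalMultilinearSeries
    (hasFPowerSeriesAt_of_hasSum_pow_smul hd)
  funext n
  simpa using congrArg (fun p : FormalMultilinearSeries ℂ ℂ G => p.coeff n) h

/-- Diagonal Taylor coefficients of `f + l • g`, where `l` is a linear form with `l x = 1`. -/
lemma taylorAtZero_add_smul_diag [CompleteSpace G] {f g h : V → G} (l : V →L[ℂ] ℂ) {x : V}
    (hx : l x = 1) (hf : AnalyticAt ℂ f 0) (hg : AnalyticAt ℂ g 0)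
    (hh : h =ᶠ[𝓝 0] fun y => f y + l y • g y) :
    (taylorAtZero h 0 fun _ => x) = (taylorAtZero f 0 fun _ => x) ∧
      ∀ n, (taylorAtZero h (n + 1) fun _ => x) =
        (taylorAtZero f (n + 1) fun _ => x) + taylorAtZero g n fun _ => x := by
  have hA : AnalyticAt ℂ (fun y => f y + l y • g y) 0 :=
    hf.add ((l.analyticAt 0).smul hg)
  rw [taylorAtZero_congr hh]
  let d : ℕ → G := fun n => n.casesOn 0 fun n => taylorAtZero g n fun _ => x
  have key : (fun n => taylorAtZero (fun y => f y + l y • g y) n fun _ => x) =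
      fun n => (taylorAtZero f n fun _ => x) + d n := by
    refine coeff_unique_of_hasSum_pow_smul (hasSum_taylorAtZero_line hA x) ?_
    filter_upwards [hasSum_taylorAtZero_line hf x, hasSum_taylorAtZero_line hg x] with t h1 h2
    simp only [smul_add]
    refine h1.add ?_
    have h3 := h2.const_smul t
    rw [map_smul, hx, smul_eq_mul, mul_one, ← hasSum_nat_add_iff' 1]
    simpa [d, pow_succ', mul_smul] using h3
  refine ⟨by simpa [d] using congrFun key 0, fun n => congrFun key (n + 1)⟩

/-- A linear map into symmetric multilinear maps is continuous as soon as its diagonal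
evaluations are. -/
lemma continuous_of_continuous_diag [CompleteSpace G] [CompleteSpace H] {n : ℕ}
    (T : H →ₗ[ℂ] V [×n]→L[ℂ] G)
    (hsymm : ∀ v w (σ : Equiv.Perm (Fin n)), T v (w ∘ σ) = T v w)
    (hdiag : ∀ x, Continuous fun v => T v fun _ => x) : Continuous T := by
  refine T.continuous_of_seq_closed_graph fun u v A hu hA => ?_
  have happ (w : Fin n → V) : Tendsto (fun k => T (u k) w) atTop (𝓝 (A w)) :=
    ((ContinuousMultilinearMap.apply ℂ (fun _ : Fin n => V) G w).continuous.tendsto A).comp hA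
  have hAsymm (w : Fin n → V) (σ : Equiv.Perm (Fin n)) : A (w ∘ σ) = A w :=
    tendsto_nhds_unique (happ _) (by simpa only [hsymm] using happ w)
  have hAdiag : (fun x => A fun _ => x) = fun x => T v fun _ => x := by
    funext x
    exact tendsto_nhds_unique (happ _) (((hdiag x).tendsto v).comp hu)
  ext w
  have h1 := A.iteratedFDeriv_comp_diagonal 0 w
  have h2 := (T v).iteratedFDeriv_comp_diagonal 0 w
  rw [hAdiag, h2] at h1
  have e1 : ∀ σ : Equiv.Perm (Fin n), (T v fun i => w (σ i)) = T v w := fun σ => hsymm v w σ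
  have e2 : ∀ σ : Equiv.Perm (Fin n), (A fun i => w (σ i)) = A w := fun σ => hAsymm w σ
  simp only [e1, e2, Finset.sum_const, Finset.card_univ, Fintype.card_perm, Fintype.card_fin,
    ← Nat.cast_smul_eq_nsmul ℂ] at h1
  exact (smul_right_injective G (by exact_mod_cast n.factorial_ne_zero) h1).symm

end TaylorSeries

section BoundedSequences

variable {V G H : Type*} [NormedAddCommGroup V] [NormedSpace ℂ V]
  [NormedAddCommGroup G] [NormedSpace ℂ G] [NormedAddCommGroup H] [NormedSpace ℂ H]

lemma one_le_radius_powerSeriesOfCoeff {v : ℕ → H} (hv : ∀ n, ‖v n‖ ≤ 1) :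
    1 ≤ (powerSeriesOfCoeff v).radius := by
  simpa using (powerSeriesOfCoeff v).le_radius_of_bound 1 (r := 1)
    fun n => by simpa [powerSeriesOfCoeff] using hv n

lemma analyticAt_tsum_pow_smul_s18 [CompleteSpace H] {v : ℕ → H} (hv : ∀ n, ‖v n‖ ≤ 1) :
    AnalyticAt ℂ (fun t : ℂ => ∑' n, t ^ n • v n) 0 := by
  have h := (powerSeriesOfCoeff v).hasFPowerSeriesOnBall
    (zero_lt_one.trans_le (one_le_radius_powerSeriesOfCoeff hv))
  have e : (powerSeriesOfCoeff v).sum = fun t : ℂ => ∑' n, t ^ n • v n := by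
    funext t
    simp [FormalMultilinearSeries.sum]
  exact e ▸ h.analyticAt

lemma analyticAt_tsum_pow_smul_comp [CompleteSpace H] {v : ℕ → H} (hv : ∀ n, ‖v n‖ ≤ 1)
    (l : V →L[ℂ] ℂ) : AnalyticAt ℂ (fun x : V => ∑' n, l x ^ n • v n) 0 := by
  have h := analyticAt_tsum_pow_smul_s18 hv
  rw [← map_zero l] at h
  exact h.comp (l.analyticAt 0)

lemma tsum_pow_smul_eq [CompleteSpace H] {v : ℕ → H} (hv : ∀ n, ‖v n‖ ≤ 1) {t : ℂ}
    (ht : ‖t‖ < 1) :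
    ∑' n, t ^ n • v n = v 0 + t • ∑' n, t ^ n • v (n + 1) := by
  have hs : ∀ w : ℕ → H, (∀ n, ‖w n‖ ≤ 1) → Summable fun n => t ^ n • w n := fun w hw =>
    Summable.of_norm_bounded (summable_geometric_of_lt_one (norm_nonneg t) ht) fun n => by
      rw [norm_smul, norm_pow]
      exact mul_le_of_le_one_right (by positivity) (hw n)
  rw [(hs v hv).tsum_eq_zero_add, ← (hs _ fun n => hv (n + 1)).tsum_const_smul]
  simp [pow_succ', mul_smul]

lemma tsum_pow_smul_comp_eventuallyEq [CompleteSpace H] {v : ℕ → H} (hv : ∀ n, ‖v n‖ ≤ 1)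
    (l : V →L[ℂ] ℂ) :
    (fun x : V => ∑' n, l x ^ n • v n) =ᶠ[𝓝 0]
      fun x => v 0 + l x • ∑' n, l x ^ n • v (n + 1) := by
  have h : Tendsto (fun x => ‖l x‖) (𝓝 0) (𝓝 0) := by
    simpa using l.continuous.norm.tendsto 0
  filter_upwards [h.eventually (gt_mem_nhds zero_lt_one)] with x hx
  exact tsum_pow_smul_eq hv hx

/-- The sequence `v k = u (B k + ‖∑ j < k, b k j (v j)‖)`, defined recursively. -/
noncomputable def dominatingSeq (u : ℝ → H) (B : ℕ → ℝ) (b : ℕ → ℕ → H → G) (k : ℕ) : H :=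
  u (B k + ‖∑ j : Fin k, b k j (dominatingSeq u B b j)‖)
termination_by k
decreasing_by exact j.2

/-- If all convolutions of a sequence of linear maps with sequences in the unit ball grow at most
exponentially, then the linear maps are continuous. -/
lemma continuous_of_convolution_bound (a : ℕ → H →ₗ[ℂ] G)
    (ha : ∀ v : ℕ → H, (∀ n, ‖v n‖ ≤ 1) →
      ∃ C R : ℝ, ∀ k, ‖∑ j ∈ Finset.range (k + 1), a (k - j) (v j)‖ ≤ C * R ^ k) (n : ℕ) :
    Continuous (a n) := by
  induction n using Nat.strong_induction_on with
  | _ n ih =>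
  by_contra hn
  have hunb : ∀ B : ℝ, ∃ v : H, ‖v‖ ≤ 1 ∧ B ≤ ‖a n v‖ := by
    by_contra! h
    obtain ⟨B, hB⟩ := h
    refine hn (AddMonoidHomClass.continuous_of_bound (a n) B fun v => ?_)
    rcases eq_or_ne v 0 with rfl | hv
    · simp
    have hv' : 0 < ‖v‖ := norm_pos_iff.2 hv
    have h := (hB ((‖v‖⁻¹ : ℂ) • v) (by simp [norm_smul, hv'.ne'])).le
    rw [map_smul, norm_smul, norm_inv, Complex.norm_real, norm_norm, inv_mul_le_iff₀ hv'] at h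
    linarith
  choose u hu1 hu using hunb
  have hcont : ∀ m, ∃ M : ℝ, 0 ≤ M ∧ (m < n → ∀ v : H, ‖v‖ ≤ 1 → ‖a m v‖ ≤ M) := by
    intro m
    by_cases hm : m < n
    · refine ⟨‖(⟨a m, ih m hm⟩ : H →L[ℂ] G)‖, norm_nonneg _, fun _ v hv => ?_⟩
      exact ContinuousLinearMap.unit_le_opNorm (⟨a m, ih m hm⟩ : H →L[ℂ] G) v hv
    · exact ⟨0, le_rfl, fun h => absurd h hm⟩
  choose M hM0 hM using hcont
  let D : ℝ := ∑ m ∈ Finset.range n, M m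
  let v := dominatingSeq u (fun k => D + (k : ℝ) ^ (n + k + 1) + 1) fun k j => a (n + k - j)
  have hvdef : ∀ k, v k = u (D + (k : ℝ) ^ (n + k + 1) + 1 +
      ‖∑ j ∈ Finset.range k, a (n + k - j) (v j)‖) := by
    intro k
    rw [← Fin.sum_univ_eq_sum_range (fun j => a (n + k - j) (v j))]
    exact dominatingSeq.eq_1 ..
  have hv1 : ∀ k, ‖v k‖ ≤ 1 := fun k => by rw [hvdef]; exact hu1 _
  obtain ⟨C, R, hCR⟩ := ha v hv1
  obtain ⟨k, hk⟩ := exists_nat_ge (max |C| |R|)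
  have hkC : |C| ≤ k := (le_max_left _ _).trans hk
  have hkR : |R| ≤ k := (le_max_right _ _).trans hk
  have hup : C * R ^ (n + k) ≤ (k : ℝ) ^ (n + k + 1) :=
    calc C * R ^ (n + k) ≤ |C * R ^ (n + k)| := le_abs_self _
      _ = |C| * |R| ^ (n + k) := by rw [abs_mul, abs_pow]
      _ ≤ k * (k : ℝ) ^ (n + k) := by gcongr
      _ = (k : ℝ) ^ (n + k + 1) := by ring
  have hsplit : ∑ j ∈ Finset.range (n + k + 1), a (n + k - j) (v j) =
      ∑ j ∈ Finset.range k, a (n + k - j) (v j) + a n (v k) +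
        ∑ i ∈ Finset.range n, a (n - 1 - i) (v (k + 1 + i)) := by
    rw [show n + k + 1 = k + 1 + n by omega, Finset.sum_range_add, Finset.sum_range_succ,
      Nat.add_sub_cancel]
    congr 1
    refine Finset.sum_congr rfl fun i _ => ?_
    rw [show n + k - (k + 1 + i) = n - 1 - i by omega]
  have htail : ‖∑ i ∈ Finset.range n, a (n - 1 - i) (v (k + 1 + i))‖ ≤ D := by
    refine (norm_sum_le_of_le (n := fun i => M (n - 1 - i)) _ fun i hi => ?_).trans
      (Finset.sum_range_reflect M n).le
    exact hM _ (by have := Finset.mem_range.1 hi; omega) _ (hv1 _)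
  have hlow : D + (k : ℝ) ^ (n + k + 1) + 1 + ‖∑ j ∈ Finset.range k, a (n + k - j) (v j)‖ ≤
      ‖a n (v k)‖ := by
    conv_rhs => rw [hvdef]
    exact hu _
  have htot := (hCR (n + k)).trans hup
  rw [hsplit] at htot
  set S := ∑ j ∈ Finset.range k, a (n + k - j) (v j)
  set Q := ∑ i ∈ Finset.range n, a (n - 1 - i) (v (k + 1 + i))
  have htri : ‖a n (v k)‖ ≤ ‖S + a n (v k) + Q‖ + ‖S‖ + ‖Q‖ :=
    calc ‖a n (v k)‖ = ‖S + a n (v k) + Q - S - Q‖ := by congr 1; abel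
      _ ≤ _ := (norm_sub_le _ _).trans (by gcongr; exact norm_sub_le _ _)
  linarith

/-- The operator-valued formal series obtained by exchanging the arguments of a sequence of
operators into spaces of multilinear maps. -/
noncomputable def flipSeries (T : ∀ n, H →L[ℂ] V [×n]→L[ℂ] G) :
    FormalMultilinearSeries ℂ V (H →L[ℂ] G) := fun n => (T n).flipMultilinear

lemma norm_flipSeries_le (T : ∀ n, H →L[ℂ] V [×n]→L[ℂ] G) (n : ℕ) :
    ‖flipSeries T n‖ ≤ ‖T n‖ :=
  ContinuousMultilinearMap.opNorm_le_bound (norm_nonneg (T n)) fun w =>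
    ContinuousLinearMap.opNorm_le_bound _ (by positivity) fun x => by
      rw [mul_right_comm]
      exact (T n x).le_of_opNorm_le ((T n).le_opNorm x) w

lemma radius_flipSeries_pos (T : ∀ n, H →L[ℂ] V [×n]→L[ℂ] G) {C : ℝ} {m : ℕ}
    (hT : ∀ n, ‖T n‖ ≤ C * (m : ℝ) ^ (n + 1)) : 0 < (flipSeries T).radius := by
  have hm : (m : ℝ) * (m + 1 : ℝ)⁻¹ ≤ 1 := by
    rw [← div_eq_mul_inv, div_le_one (by positivity)]
    linarith
  have hC : 0 ≤ C * m := by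
    have h := (norm_nonneg (T 0)).trans (hT 0)
    rwa [zero_add, pow_one] at h
  refine lt_of_lt_of_le ?_ ((flipSeries T).le_radius_of_bound (C * m)
    (r := (m + 1 : NNReal)⁻¹) fun n => ?_)
  · exact ENNReal.coe_pos.2 (by positivity)
  · calc ‖flipSeries T n‖ * (((m + 1 : NNReal)⁻¹ : NNReal) : ℝ) ^ n
        ≤ C * (m : ℝ) ^ (n + 1) * ((m + 1 : ℝ)⁻¹) ^ n := by
          push_cast
          exact mul_le_mul_of_nonneg_right ((norm_flipSeries_le T n).trans (hT n)) (by positivity)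
      _ = C * m * ((m : ℝ) * (m + 1 : ℝ)⁻¹) ^ n := by ring
      _ ≤ C * m := mul_le_of_le_one_right hC (pow_le_one₀ (by positivity) hm)

lemma eventually_hasSum_flipSeries_apply [CompleteSpace G] (T : ∀ n, H →L[ℂ] V [×n]→L[ℂ] G)
    (hT : 0 < (flipSeries T).radius) (v : H) :
    ∀ᶠ x in 𝓝 (0 : V), HasSum (fun n => T n v fun _ => x) ((flipSeries T).sum x v) := by
  filter_upwards [((flipSeries T).hasFPowerSeriesOnBall hT).eventually_hasSum] with x hx
  rw [zero_add] at hx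
  exact hx.mapL (ContinuousLinearMap.apply ℂ G v)

end BoundedSequences

section Baire
variable {H : Type*} [NormedAddCommGroup H] [NormedSpace ℂ H] [CompleteSpace H]
  {W : ℕ → Type*} [∀ n, NormedAddCommGroup (W n)] [∀ n, NormedSpace ℂ (W n)]

/-- Uniform boundedness principle for exponential growth. -/
lemma exists_opNorm_le_of_pointwise_growth (T : ∀ n, H →L[ℂ] W n)
    (hT : ∀ v, ∃ m : ℕ, ∀ n, ‖T n v‖ ≤ (m : ℝ) ^ (n + 1)) :
    ∃ C : ℝ, ∃ m : ℕ, ∀ n, ‖T n‖ ≤ C * (m : ℝ) ^ (n + 1) := by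
  let A : ℕ → Set H := fun m => {v | ∀ n, ‖T n v‖ ≤ (m : ℝ) ^ (n + 1)}
  have hA : ∀ m, IsClosed (A m) := fun m => by
    simp only [A, Set.ofPred_forall]
    exact isClosed_iInter fun n => isClosed_le (T n).continuous.norm continuous_const
  have hU : ⋃ m, A m = Set.univ := Set.eq_univ_of_forall fun v => Set.mem_iUnion.2 (hT v)
  obtain ⟨m, v₀, hv₀⟩ := nonempty_interior_of_iUnion_of_closed hA hU
  obtain ⟨ε, hε, hball⟩ := Metric.mem_nhds_iff.1 (mem_interior_iff_mem_nhds.1 hv₀)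
  refine ⟨2 * (ε / 2)⁻¹, m, fun n => ?_⟩
  refine ContinuousLinearMap.opNorm_le_bound _ (by positivity) fun v => ?_
  rcases eq_or_ne v 0 with rfl | hv
  · simp
  have hv' : 0 < ‖v‖ := norm_pos_iff.2 hv
  let c : ℂ := ((ε / 2 * ‖v‖⁻¹ : ℝ) : ℂ)
  have hc : ‖c‖ = ε / 2 * ‖v‖⁻¹ := by
    rw [Complex.norm_real, Real.norm_of_nonneg (by positivity)]
  have h1 : v₀ + c • v ∈ A m := hball (by
    rw [Metric.mem_ball, dist_eq_norm, add_sub_cancel_left, norm_smul, hc,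
      inv_mul_cancel_right₀ hv'.ne']
    linarith)
  have h2 : v₀ ∈ A m := hball (Metric.mem_ball_self hε)
  have h3 : ‖c‖ * ‖T n v‖ ≤ 2 * (m : ℝ) ^ (n + 1) := by
    rw [← norm_smul, ← map_smul, ← add_sub_cancel_left v₀ (c • v), map_sub]
    exact (norm_sub_le _ _).trans (by linarith [h1 n, h2 n])
  rw [hc] at h3
  have h4 : ‖T n v‖ = (ε / 2)⁻¹ * ‖v‖ * (ε / 2 * ‖v‖⁻¹ * ‖T n v‖) := by
    field_simp
  rw [h4]
  calc _ ≤ (ε / 2)⁻¹ * ‖v‖ * (2 * (m : ℝ) ^ (n + 1)) := by gcongr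
    _ = _ := by ring

end Baire

section GermModules

variable {X E} {F : Type*} [NormedAddCommGroup F] [NormedSpace ℂ F]

/-- A function representing a holomorphic germ. -/
noncomputable def germRep {ζ : X} (g : OEat X F ζ) : X → F := g.2.choose

lemma analyticAt_germRep {ζ : X} (g : OEat X F ζ) : AnalyticAt ℂ (germRep g) ζ :=
  g.2.choose_spec.1

lemma coe_germRep {ζ : X} (g : OEat X F ζ) :
    ((germRep g : X → F) : Filter.Germ (𝓝 ζ) F) = g :=
  g.2.choose_spec.2.symm

/-- The scalar germ of a function analytic at `ζ`. -/
noncomputable def scalarGerm {ζ : X} (f : X → ℂ) (hf : AnalyticAt ℂ f ζ) : Oat X ζ :=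
  ⟨(f : Filter.Germ (𝓝 ζ) ℂ), f, hf, rfl⟩

lemma germRep_add {ζ : X} (g h : OEat X F ζ) :
    germRep (g + h) =ᶠ[𝓝 ζ] germRep g + germRep h := by
  rw [← Filter.Germ.coe_eq, Filter.Germ.coe_add, coe_germRep, coe_germRep, coe_germRep]
  rfl

lemma germRep_smul {ζ : X} (f : X → ℂ) (hf : AnalyticAt ℂ f ζ) (g : OEat X F ζ) :
    germRep (scalarGerm f hf • g) =ᶠ[𝓝 ζ] fun x => f x • germRep g x := by
  rw [← Filter.Germ.coe_eq, coe_germRep]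
  change (f : Filter.Germ (𝓝 ζ) ℂ) • (g : Filter.Germ (𝓝 ζ) F) = _
  rw [← coe_germRep g]
  rfl

lemma constGerm_add (ζ : X) (v w : E) :
    constGerm X E ζ (v + w) = constGerm X E ζ v + constGerm X E ζ w := rfl

lemma constGerm_smul (ζ : X) (c : ℂ) (v : E) :
    constGerm X E ζ (c • v) = scalarGerm (ζ := ζ) (fun _ => c) analyticAt_const • constGerm X E ζ v := rfl

variable [CompleteSpace F] (φ : OEat X E 0 →ₗ[Oat X 0] OEat X F 0)

/-- The `n`-th Taylor coefficient of `φ ṽ`, as a linear function of `v`. -/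
noncomputable def constTaylor (n : ℕ) : E →ₗ[ℂ] X [×n]→L[ℂ] F where
  toFun v := taylorAtZero (germRep (φ (constGerm X E 0 v))) n
  map_add' v w := by
    rw [constGerm_add, map_add, taylorAtZero_congr (germRep_add _ _),
      taylorAtZero_add (analyticAt_germRep _) (analyticAt_germRep _)]
  map_smul' c v := by
    rw [constGerm_smul, map_smul, taylorAtZero_congr (germRep_smul _ _ _)]
    exact taylorAtZero_const_smul (analyticAt_germRep _) c n

lemma germOf_tsum_eq [CompleteSpace E] {v : ℕ → E} (hv : ∀ n, ‖v n‖ ≤ 1) (l : X →L[ℂ] ℂ) :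
    germOf X E 0 _ (analyticAt_tsum_pow_smul_comp hv l) = constGerm X E 0 (v 0) +
      scalarGerm l (l.analyticAt 0) •
        germOf X E 0 _ (analyticAt_tsum_pow_smul_comp (fun n => hv (n + 1)) l) :=
  Subtype.ext (Filter.Germ.coe_eq.2 (tsum_pow_smul_comp_eventuallyEq hv l))

lemma taylorAtZero_map_tsum_diag [CompleteSpace E] (l : X →L[ℂ] ℂ) {x : X} (hx : l x = 1)
    (k : ℕ) : ∀ {v : ℕ → E} (hv : ∀ n, ‖v n‖ ≤ 1),
    (taylorAtZero (germRep (φ (germOf X E 0 _ (analyticAt_tsum_pow_smul_comp hv l)))) k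
      fun _ => x) = ∑ j ∈ Finset.range (k + 1), constTaylor φ (k - j) (v j) fun _ => x := by
  have key {v : ℕ → E} (hv : ∀ n, ‖v n‖ ≤ 1) :
      germRep (φ (germOf X E 0 _ (analyticAt_tsum_pow_smul_comp hv l))) =ᶠ[𝓝 0]
        fun y => germRep (φ (constGerm X E 0 (v 0))) y + l y • germRep (φ (germOf X E 0 _
          (analyticAt_tsum_pow_smul_comp (fun n => hv (n + 1)) l))) y := by
    rw [germOf_tsum_eq hv, map_add, map_smul]
    refine (germRep_add _ _).trans ?_
    filter_upwards [germRep_smul l (l.analyticAt 0) (φ (germOf X E 0 _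
      (analyticAt_tsum_pow_smul_comp (fun n => hv (n + 1)) l)))] with y hy
    rw [Pi.add_apply, hy]
  induction k with
  | zero =>
    intro v hv
    rw [(taylorAtZero_add_smul_diag l hx (analyticAt_germRep _) (analyticAt_germRep _)
      (key hv)).1]
    simp [constTaylor]
  | succ k ih =>
    intro v hv
    rw [(taylorAtZero_add_smul_diag l hx (analyticAt_germRep _) (analyticAt_germRep _)
      (key hv)).2, ih fun n => hv (n + 1), Finset.sum_range_succ' _ (k + 1), add_comm]
    refine congrArg₂ (· + ·) (Finset.sum_congr rfl fun j _ => ?_) rfl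
    rw [Nat.add_sub_add_right]

lemma continuous_constTaylor_diag [CompleteSpace E] (n : ℕ) {x : X} (hx : x ≠ 0) :
    Continuous fun v => constTaylor φ n v fun _ => x := by
  obtain ⟨l, hl⟩ := SeparatingDual.exists_eq_one (R := ℂ) hx
  let a : ℕ → E →ₗ[ℂ] F := fun k =>
    (ContinuousMultilinearMap.apply ℂ (fun _ : Fin k => X) F fun _ => x).toLinearMap ∘ₗ
      constTaylor φ k
  refine continuous_of_convolution_bound a (fun v hv => ?_) n
  obtain ⟨m, hm⟩ := exists_norm_taylorAtZero_le
    (analyticAt_germRep (φ (germOf X E 0 _ (analyticAt_tsum_pow_smul_comp hv l))))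
  refine ⟨m, m * ‖x‖, fun k => ?_⟩
  have h := taylorAtZero_map_tsum_diag φ l hl k hv
  change ‖∑ j ∈ Finset.range (k + 1), constTaylor φ (k - j) (v j) fun _ => x‖ ≤ _
  rw [← h]
  refine (ContinuousMultilinearMap.le_opNorm _ _).trans ?_
  rw [Finset.prod_const, Finset.card_univ, Fintype.card_fin, mul_pow, ← mul_assoc, ← pow_succ']
  gcongr
  exact hm k

lemma continuous_constTaylor [Nontrivial X] [CompleteSpace E] (n : ℕ) :
    Continuous (constTaylor φ n) := by
  refine continuous_of_continuous_diag _
    (fun v w σ => taylorAtZero_comp_perm (analyticAt_germRep _) w σ) fun x => ?_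
  rcases eq_or_ne x 0 with rfl | hx
  · cases n with
    | zero =>
      obtain ⟨y, hy⟩ := exists_ne (0 : X)
      simpa only [Subsingleton.elim (fun _ : Fin 0 => (0 : X)) fun _ => y] using
        continuous_constTaylor_diag φ 0 hy
    | succ n =>
      have (v : E) : (constTaylor φ (n + 1) v fun _ => (0 : X)) = 0 :=
        (constTaylor φ (n + 1) v).map_coord_zero 0 rfl
      simpa only [this] using continuous_const
  · exact continuous_constTaylor_diag φ n hx

lemma exists_analyticAt_apply_eq_map_constGerm [Nontrivial X] [CompleteSpace E] :
    ∃ Φ : X → E →L[ℂ] F, AnalyticAt ℂ Φ 0 ∧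
      ∀ v, ∀ᶠ x in 𝓝 0, germRep (φ (constGerm X E 0 v)) x = Φ x v := by
  let T : ∀ n, E →L[ℂ] X [×n]→L[ℂ] F := fun n => ⟨constTaylor φ n, continuous_constTaylor φ n⟩
  obtain ⟨C, m, hCm⟩ := exists_opNorm_le_of_pointwise_growth T fun v =>
    exists_norm_taylorAtZero_le (analyticAt_germRep (φ (constGerm X E 0 v)))
  have hrad := radius_flipSeries_pos T hCm
  refine ⟨(flipSeries T).sum, ((flipSeries T).hasFPowerSeriesOnBall hrad).analyticAt, fun v => ?_⟩
  filter_upwards [hasSum_taylorAtZero (analyticAt_germRep (φ (constGerm X E 0 v))),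
    eventually_hasSum_flipSeries_apply T hrad v] with x h1 h2
  exact h1.unique h2

/-- The homomorphism of germ modules induced by an operator-valued holomorphic germ. -/
noncomputable def plainHom (Φ : X → E →L[ℂ] F) {ζ : X} (hΦ : AnalyticAt ℂ Φ ζ) :
    OEat X E ζ →ₗ[Oat X ζ] OEat X F ζ where
  toFun g := ⟨Filter.Germ.map₂ (fun A e => A e) (Φ : Filter.Germ (𝓝 ζ) (E →L[ℂ] F)) g, by
    obtain ⟨_, f, hf, rfl⟩ := g
    exact ⟨fun x => Φ x (f x), ((ContinuousLinearMap.id ℂ (E →L[ℂ] F)).analyticAt_bilinear (Φ ζ, f ζ)).comp₂ hΦ hf, rfl⟩⟩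
  map_add' := by
    rintro ⟨_, f, hf, rfl⟩ ⟨_, k, hk, rfl⟩
    exact Subtype.ext (Filter.Germ.coe_eq.2 (.of_forall fun x => (Φ x).map_add (f x) (k x)))
  map_smul' := by
    rintro ⟨_, a, ha, rfl⟩ ⟨_, f, hf, rfl⟩
    exact Subtype.ext (Filter.Germ.coe_eq.2 (.of_forall fun x => (Φ x).map_smul (a x) (f x)))

end GermModules

/-- For any `O_0`-homomorphism `φ : O^E_0 → O^F_0` of germ modules at `0` in
a Banach space `X` with `dim X > 0`, there is a plain homomorphism `ψ` (induced by a
`Hom(E,F)`-valued holomorphic germ `Φ`) agreeing with `φ` on all constant germs. -/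
theorem exists_plain_hom_agreeing_on_constants
    [CompleteSpace X] [Nontrivial X] [CompleteSpace E]
    (F : Type*) [NormedAddCommGroup F] [NormedSpace ℂ F] [CompleteSpace F]
    (φ : OEat X E 0 →ₗ[Oat X 0] OEat X F 0) :
    ∃ (Φ : X → (E →L[ℂ] F)) (hΦ : AnalyticAt ℂ Φ 0)
      (ψ : OEat X E 0 →ₗ[Oat X 0] OEat X F 0),
      (∀ (f : X → E) (hf : AnalyticAt ℂ f 0),
        ((ψ (germOf X E 0 f hf) : OEat X F 0) : Filter.Germ (𝓝 (0 : X)) F) =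
          ↑(fun x => Φ x (f x))) ∧
      ∀ v : E, φ (constGerm X E 0 v) = ψ (constGerm X E 0 v) := by
  obtain ⟨Φ, hΦ, h⟩ := exists_analyticAt_apply_eq_map_constGerm φ
  refine ⟨Φ, hΦ, plainHom Φ hΦ, fun f hf => rfl, fun v => Subtype.ext ?_⟩
  rw [← coe_germRep (φ (constGerm X E 0 v))]
  exact Filter.Germ.coe_eq.2 (h v)
end
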